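/- Let Ω be an n-connected quadrature domain of finite area with no degenerate boundary components, and let f be a proper holomorphic map of Ω onto the open unit disc 𝔻. Then f and its complex derivative f' are algebraically dependent: there exists a nonzero polynomial P ∈ ℂ[X,Y] such that P(f'(z), f(z)) = 0 for all z ∈ Ω. -/

import Mathlib

open MeasureTheory Complex ComplexConjugate Metric Set

noncomputable section

/-- `f` belongs to the Bergman space `A²(Ω)`. -/
def BergmanFun (Ω : Set ℂ) (f : ℂ → ℂ) : Prop :=
  DifferentiableOn ℂ f Ω ∧ IntegrableOn (fun z => ‖f z‖ ^ 2) Ω volume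

/-- `Ω` is a finitely connected domain none of whose complementary components is a point. -/
def IsFinConnDomain (Ω : Set ℂ) : Prop :=
  IsOpen Ω ∧ IsConnected Ω ∧
  {C : Set ℂ | ∃ x ∈ Ωᶜ, C = connectedComponentIn Ωᶜ x}.Finite ∧
  ∀ x ∈ Ωᶜ, ¬ (connectedComponentIn Ωᶜ x).Subsingleton

/-- `Ω` is a quadrature domain. -/
def IsQuadratureDomain (Ω : Set ℂ) : Prop :=
  ∃ N : ℕ, 0 < N ∧ ∃ (w : Fin N → ℂ) (n : Fin N → ℕ) (c : Fin N → ℕ → ℂ),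
    (∀ j, w j ∈ Ω) ∧
    ∀ f : ℂ → ℂ, BergmanFun Ω f →
      (∫ z in Ω, f z) =
        ∑ j, ∑ k ∈ Finset.range (n j + 1), c j k * iteratedDerivWithin k f Ω (w j)

/-- `fa` is an Ahlfors map of `Ω` at `a`. -/
def IsAhlforsMap (Ω : Set ℂ) (a : ℂ) (fa : ℂ → ℂ) : Prop :=
  DifferentiableOn ℂ fa Ω ∧ (∀ z ∈ Ω, ‖fa z‖ < 1) ∧
  (deriv fa a).im = 0 ∧ 0 < (deriv fa a).re ∧
  ∀ g : ℂ → ℂ, DifferentiableOn ℂ g Ω → (∀ z ∈ Ω, ‖g z‖ < 1) →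
    ‖deriv g a‖ ≤ (deriv fa a).re

/-- `Ω` is bounded with `C^∞` smooth boundary consisting of finitely many disjoint
simple closed curves. -/
def HasSmoothBoundary (Ω : Set ℂ) : Prop :=
  Bornology.IsBounded Ω ∧
  ∃ (n : ℕ) (γ : Fin n → ℝ → ℂ),
    (∀ i, ContDiff ℝ (⊤ : ℕ∞) (γ i)) ∧
    (∀ i, Function.Periodic (γ i) (2 * Real.pi)) ∧
    (∀ i, InjOn (γ i) (Ico 0 (2 * Real.pi))) ∧
    (∀ i t, deriv (γ i) t ≠ 0) ∧
    (Pairwise fun i j => Disjoint (range (γ i)) (range (γ j))) ∧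
    frontier Ω = ⋃ i, range (γ i)

/-- Partial derivative in the `x`-direction of a real-valued function on `ℂ`. -/
def pdx (u : ℂ → ℝ) (z : ℂ) : ℝ := deriv (fun t : ℝ => u (z + (t : ℂ))) 0

/-- Partial derivative in the `y`-direction of a real-valued function on `ℂ`. -/
def pdy (u : ℂ → ℝ) (z : ℂ) : ℝ := deriv (fun t : ℝ => u (z + (t : ℂ) * Complex.I)) 0

/-- `f` is a proper holomorphic map of `Ω` onto the open unit disc. -/
def IsProperOntoDisc (Ω : Set ℂ) (f : ℂ → ℂ) : Prop :=
  DifferentiableOn ℂ f Ω ∧ f '' Ω = ball (0 : ℂ) 1 ∧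
  ∀ L : Set ℂ, L ⊆ ball (0 : ℂ) 1 → IsCompact L → IsCompact (Ω ∩ f ⁻¹' L)

/-- `g` is `(m, δ)`-close to the identity on `closure Ω`. -/
def CloseToId (Ω : Set ℂ) (m : ℕ) (δ : ℝ) (g : ℂ → ℂ) : Prop :=
  ∀ k ≤ m, ∀ z ∈ closure Ω, ‖iteratedFDeriv ℝ k (fun w => g w - w) z‖ ≤ δ

/-- `σ : [0,1] → ℂ` is a piecewise continuously differentiable curve. -/
def PiecewiseC1On01 (σ : ℝ → ℂ) : Prop :=
  ContinuousOn σ (Icc 0 1) ∧ ∃ s : Finset ℝ, ContDiffOn ℝ 1 σ (Icc (0 : ℝ) 1 \ s)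

/-- `Ω` is a generalized quadrature domain. -/
def IsGenQuadratureDomain (Ω : Set ℂ) : Prop :=
  ∃ (N M : ℕ) (w : Fin N → ℂ) (n : Fin N → ℕ) (c : Fin N → ℕ → ℂ)
    (b : Fin M → ℂ) (σ : Fin M → ℝ → ℂ),
    (∀ j, w j ∈ Ω) ∧
    (∀ m, PiecewiseC1On01 (σ m)) ∧
    (∀ m, ∀ t ∈ Icc (0 : ℝ) 1, σ m t ∈ Ω) ∧
    ∀ f : ℂ → ℂ, BergmanFun Ω f →
      (∫ z in Ω, f z) =
        (∑ j, ∑ k ∈ Finset.range (n j + 1), c j k * iteratedDerivWithin k f Ω (w j)) +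
        ∑ m, b m * ∫ t in (0 : ℝ)..1, f (σ m t) * deriv (σ m) t

/-- The auxiliary kernel `‖z‖ ^ (-3/2)`, which is locally integrable in the plane. -/
def rieszKernel (z : ℂ) : ℝ := (√‖z‖)⁻¹ ^ 3

lemma rieszKernel_nonneg (z : ℂ) : 0 ≤ rieszKernel z := by
  unfold rieszKernel; positivity

lemma measurable_rieszKernel : Measurable rieszKernel := by
  unfold rieszKernel; fun_prop

lemma integrableOn_rieszKernel_ball : IntegrableOn rieszKernel (ball (0 : ℂ) 1) := by
  have := (integrableOn_fun_norm_addHaar (E := ℂ) (F := ℝ) volume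
    (f := fun y => (√y)⁻¹ ^ 3) (r := 1)).2
  refine this ?_
  simp only [Complex.finrank_real_complex]
  have h : IntegrableOn (fun y : ℝ => y ^ (-(1/2) : ℝ)) (Ioo 0 1) := by
    have := (intervalIntegral.intervalIntegrable_rpow' (a := 0) (b := 1) (r := -(1/2))
      (by norm_num)).1
    exact this.mono_set Ioo_subset_Ioc_self
  refine h.congr_fun ?_ measurableSet_Ioo
  intro y hy
  have hy0 : 0 < y := hy.1
  have hs : √y ≠ 0 := (Real.sqrt_pos.2 hy0).ne'
  have h2 : y = √y ^ 2 := (Real.sq_sqrt hy0.le).symm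
  simp only [smul_eq_mul]
  rw [Real.rpow_neg hy0.le, ← Real.sqrt_eq_rpow]
  have : y ^ (2 - 1) * (√y)⁻¹ ^ 3 = √y ^ 2 * (√y)⁻¹ ^ 3 := by
    rw [← h2]; simp
  rw [this]
  field_simp

lemma exists_rieszKernel_bound {Ω : Set ℂ} (hA : volume Ω < ⊤) :
    ∃ M : ℝ, 0 ≤ M ∧ ∀ a, IntegrableOn (fun z => rieszKernel (z - a)) Ω ∧
      ∫ z in Ω, rieszKernel (z - a) ≤ M := by
  set g : ℂ → ℝ := (ball (0 : ℂ) 1).indicator rieszKernel with hg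
  have hgi : Integrable g := integrableOn_rieszKernel_ball.integrable_indicator measurableSet_ball
  have hg0 : ∀ z, 0 ≤ g z := fun z => indicator_nonneg (fun z _ => rieszKernel_nonneg z) z
  have hle : ∀ z, rieszKernel z ≤ g z + 1 := by
    intro z
    by_cases hz : z ∈ ball (0 : ℂ) 1
    · simp [hg, hz]
    · simp only [hg, indicator_of_notMem hz, zero_add]
      have h1 : 1 ≤ ‖z‖ := by simpa using hz
      unfold rieszKernel
      exact pow_le_one₀ (by positivity) (inv_le_one_of_one_le₀ (Real.one_le_sqrt.2 h1))
  have hc : IntegrableOn (fun _ : ℂ => (1 : ℝ)) Ω := integrableOn_const hA.ne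
  have hdom : ∀ a, IntegrableOn (fun z => g (z - a) + 1) Ω := fun a =>
    (hgi.comp_sub_right a).integrableOn.add hc
  have hint : ∀ a, IntegrableOn (fun z => rieszKernel (z - a)) Ω := by
    intro a
    refine (hdom a).mono' ?_ (ae_of_all _ fun z => ?_)
    · exact (measurable_rieszKernel.comp (measurable_id.sub_const a)).aestronglyMeasurable
    · rw [Real.norm_of_nonneg (rieszKernel_nonneg _)]; exact hle _
  refine ⟨(∫ z, g z) + volume.real Ω, add_nonneg (integral_nonneg hg0) (by simp), fun a =>
    ⟨hint a, ?_⟩⟩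
  calc ∫ z in Ω, rieszKernel (z - a) ≤ ∫ z in Ω, (g (z - a) + 1) :=
        integral_mono (hint a) (hdom a) fun z => hle _
    _ = (∫ z in Ω, g (z - a)) + ∫ z in Ω, (1 : ℝ) :=
        integral_add (hgi.comp_sub_right a).integrableOn hc
    _ ≤ (∫ z, g (z - a)) + volume.real Ω := by
        gcongr
        · exact ae_of_all _ fun z => hg0 _
        · exact hgi.comp_sub_right a
        · exact Measure.restrict_le_self
        · simp
    _ = _ := by rw [integral_sub_right_eq_self]

lemma norm_inv_sub_inv_le (u v : ℂ) :
    ‖u⁻¹ - v⁻¹‖ ≤ √‖u - v‖ * (rieszKernel u + rieszKernel v) := by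
  unfold rieszKernel
  by_cases hu : u = 0
  · subst hu
    by_cases hv : v = 0
    · simp [hv]
    have hy : 0 < √‖v‖ := Real.sqrt_pos.2 (norm_pos_iff.2 hv)
    have h2 : ‖v‖ = √‖v‖ ^ 2 := (Real.sq_sqrt (norm_nonneg _)).symm
    simp only [zero_sub, norm_neg]
    rw [h2, Real.sqrt_sq hy.le]
    apply le_of_eq
    simp
    field_simp
    exact h2.symm
  by_cases hv : v = 0
  · subst hv
    have hy : 0 < √‖u‖ := Real.sqrt_pos.2 (norm_pos_iff.2 hu)
    have h2 : ‖u‖ = √‖u‖ ^ 2 := (Real.sq_sqrt (norm_nonneg _)).symm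
    simp only [sub_zero, norm_inv, inv_zero]
    rw [h2, Real.sqrt_sq hy.le]
    apply le_of_eq
    simp
    field_simp
    exact h2.symm
  have hx : 0 < √‖u‖ := Real.sqrt_pos.2 (norm_pos_iff.2 hu)
  have hy : 0 < √‖v‖ := Real.sqrt_pos.2 (norm_pos_iff.2 hv)
  have e : ‖u⁻¹ - v⁻¹‖ = ‖u - v‖ * (‖u‖⁻¹ * ‖v‖⁻¹) := by
    rw [inv_sub_inv hu hv, norm_div, norm_mul, norm_sub_rev]
    field_simp
  have hd : ‖u - v‖ ≤ ‖u‖ + ‖v‖ := norm_sub_le _ _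
  have hu2 : ‖u‖ = √‖u‖ ^ 2 := (Real.sq_sqrt (norm_nonneg _)).symm
  have hv2 : ‖v‖ = √‖v‖ ^ 2 := (Real.sq_sqrt (norm_nonneg _)).symm
  have ht2 : ‖u - v‖ = √‖u - v‖ ^ 2 := (Real.sq_sqrt (norm_nonneg _)).symm
  have ht : 0 ≤ √‖u - v‖ := Real.sqrt_nonneg _
  rw [e]
  generalize √‖u - v‖ = t at *
  generalize √‖u‖ = x at *
  generalize √‖v‖ = y at *
  rw [hu2, hv2, ht2] at hd
  rw [hu2, hv2, ht2]
  have htxy : t ≤ x + y := by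
    apply le_of_sq_le_sq _ (by positivity)
    nlinarith
  have hX : x⁻¹ * x = 1 := inv_mul_cancel₀ hx.ne'
  have hY : y⁻¹ * y = 1 := inv_mul_cancel₀ hy.ne'
  have hX0 : 0 < x⁻¹ := by positivity
  have hY0 : 0 < y⁻¹ := by positivity
  rw [← inv_pow, ← inv_pow]
  generalize x⁻¹ = X at *
  generalize y⁻¹ = Y at *
  calc t ^ 2 * (X ^ 2 * Y ^ 2) = t * (t * (X ^ 2 * Y ^ 2)) := by ring
    _ ≤ t * ((x + y) * (X ^ 2 * Y ^ 2)) := by gcongr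
    _ = t * ((X * x) * X * Y ^ 2 + (Y * y) * Y * X ^ 2) := by ring
    _ = t * (X * Y ^ 2 + Y * X ^ 2) := by rw [hX, hY]; ring
    _ ≤ t * (X ^ 3 + Y ^ 3) := by
      refine mul_le_mul_of_nonneg_left ?_ ht
      nlinarith [mul_nonneg (add_pos hX0 hY0).le (sq_nonneg (X - Y))]

/-- The Cauchy transform of the area measure on `Ω`. -/
def cauchyTransform (Ω : Set ℂ) (w : ℂ) : ℂ := ∫ z in Ω, (z - w)⁻¹

lemma norm_inv_le_rieszKernel (z : ℂ) : ‖z⁻¹‖ ≤ rieszKernel z + 1 := by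
  unfold rieszKernel
  have h2 : ‖z‖ = √‖z‖ ^ 2 := (Real.sq_sqrt (norm_nonneg _)).symm
  rw [norm_inv]
  nth_rw 1 [h2]
  rw [← inv_pow]
  have : 0 ≤ (√‖z‖)⁻¹ := by positivity
  generalize (√‖z‖)⁻¹ = X at *
  by_cases h : X ≤ 1
  · nlinarith [pow_nonneg this 3]
  · nlinarith [pow_nonneg this 3, sq_nonneg X]

lemma integrableOn_inv_sub {Ω : Set ℂ} (hA : volume Ω < ⊤) (w : ℂ) :
    IntegrableOn (fun z => (z - w)⁻¹) Ω := by
  obtain ⟨M, -, hM⟩ := exists_rieszKernel_bound hA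
  refine ((hM w).1.add (integrableOn_const (C := (1 : ℝ)) hA.ne)).mono' ?_
    (ae_of_all _ fun z => norm_inv_le_rieszKernel _)
  exact (measurable_id.sub_const w).inv.aestronglyMeasurable

lemma exists_norm_cauchyTransform_le {Ω : Set ℂ} (hA : volume Ω < ⊤) :
    ∃ M : ℝ, 0 ≤ M ∧ ∀ w, ∫ z in Ω, ‖(z - w)⁻¹‖ ≤ M := by
  obtain ⟨M, hM0, hM⟩ := exists_rieszKernel_bound hA
  have hc : IntegrableOn (fun _ : ℂ => (1 : ℝ)) Ω := integrableOn_const hA.ne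
  refine ⟨M + volume.real Ω, add_nonneg hM0 (by simp), fun w => ?_⟩
  calc ∫ z in Ω, ‖(z - w)⁻¹‖ ≤ ∫ z in Ω, (rieszKernel (z - w) + 1) :=
        integral_mono (integrableOn_inv_sub hA w).norm ((hM w).1.add hc)
          fun z => norm_inv_le_rieszKernel _
    _ = (∫ z in Ω, rieszKernel (z - w)) + ∫ z in Ω, (1 : ℝ) := integral_add (hM w).1 hc
    _ ≤ M + volume.real Ω := by
        gcongr
        · exact (hM w).2
        · simp

lemma continuous_cauchyTransform {Ω : Set ℂ} (hA : volume Ω < ⊤) :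
    Continuous (cauchyTransform Ω) := by
  obtain ⟨M, hM0, hM⟩ := exists_rieszKernel_bound hA
  have key : ∀ w w', ‖cauchyTransform Ω w - cauchyTransform Ω w'‖ ≤ √‖w' - w‖ * (M + M) := by
    intro w w'
    unfold cauchyTransform
    rw [← integral_sub (integrableOn_inv_sub hA w) (integrableOn_inv_sub hA w')]
    calc _ ≤ ∫ z in Ω, √‖w' - w‖ * (rieszKernel (z - w) + rieszKernel (z - w')) := by
          apply norm_integral_le_of_norm_le
          · exact ((hM w).1.add (hM w').1).const_mul _
          · refine ae_of_all _ fun z => ?_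
            have := norm_inv_sub_inv_le (z - w) (z - w')
            rwa [sub_sub_sub_cancel_left] at this
      _ = √‖w' - w‖ * ((∫ z in Ω, rieszKernel (z - w)) + ∫ z in Ω, rieszKernel (z - w')) := by
          rw [integral_const_mul, integral_add (hM w).1 (hM w').1]
      _ ≤ _ := by
          gcongr
          · exact (hM w).2
          · exact (hM w').2
  rw [continuous_iff_continuousAt]
  intro w
  rw [ContinuousAt, tendsto_iff_norm_sub_tendsto_zero]
  refine squeeze_zero (fun _ => norm_nonneg _) (fun v => key v w) ?_
  have : Continuous fun v => √‖w - v‖ * (M + M) := by fun_prop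
  simpa using this.tendsto w

lemma integral_eq_integral_circleAverage {f : ℂ → ℂ} (hfm : Measurable f)
    (hf : Integrable f) :
    ∫ z, f z = ∫ r in Ioi (0 : ℝ), r • ((2 * Real.pi) • Real.circleAverage f 0 r) := by
  have hsymm : ∀ p : ℝ × ℝ, Complex.polarCoord.symm p = circleMap 0 p.1 p.2 := by
    intro p
    rw [Complex.polarCoord_symm_apply, circleMap, zero_add, Complex.exp_mul_I]
    simp
  have hcont : Continuous fun p : ℝ × ℝ => circleMap 0 p.1 p.2 := by
    unfold circleMap; fun_prop
  have hmeas : AEStronglyMeasurable (fun p : ℝ × ℝ => p.1 • f (Complex.polarCoord.symm p))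
      (volume.restrict polarCoord.target) := by
    simp_rw [hsymm]
    exact (measurable_fst.smul (hfm.comp hcont.measurable)).aestronglyMeasurable
  have hint : Integrable (fun p : ℝ × ℝ => p.1 • f (Complex.polarCoord.symm p))
      (volume.restrict polarCoord.target) := by
    refine ⟨hmeas, ?_⟩
    have := hf.2
    rw [HasFiniteIntegral, ← Complex.lintegral_comp_polarCoord_symm] at this
    refine lt_of_le_of_lt (setLIntegral_mono_ae' polarCoord.open_target.measurableSet
      (ae_of_all _ fun p hp => ?_)) this
    have : 0 < p.1 := hp.1
    rw [enorm_smul, Real.enorm_of_nonneg this.le, smul_eq_mul]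
  rw [← Complex.integral_comp_polarCoord_symm]
  have ht : polarCoord.target = Ioi (0 : ℝ) ×ˢ Ioo (-Real.pi) Real.pi := rfl
  rw [ht] at hint ⊢
  rw [Measure.volume_eq_prod] at hint ⊢
  rw [setIntegral_prod _ hint]
  refine setIntegral_congr_fun measurableSet_Ioi fun r hr => ?_
  simp only
  rw [integral_smul, Real.circleAverage_eq_integral_add (-Real.pi),
    intervalIntegral.integral_comp_add_right (fun θ => f (circleMap 0 r θ)),
    smul_smul (2 * Real.pi),
    mul_inv_cancel₀ (by positivity), one_smul,
    intervalIntegral.integral_of_le (by linarith [Real.pi_pos]),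
    integral_Ioc_eq_integral_Ioo]
  simp_rw [hsymm]
  rw [zero_add, show 2 * Real.pi + -Real.pi = Real.pi by ring]

lemma circleAverage_inv_sub_of_lt {w : ℂ} {r : ℝ} (h0 : 0 < r) (hr : r < ‖w‖) :
    Real.circleAverage (fun z => (z - w)⁻¹) 0 r = -w⁻¹ := by
  have : DiffContOnCl ℂ (fun z => (z - w)⁻¹) (ball 0 |r|) := by
    refine DifferentiableOn.diffContOnCl fun z hz => ?_
    have hz' : z ∈ closedBall (0 : ℂ) |r| := closure_ball_subset_closedBall hz
    rw [mem_closedBall_zero_iff, abs_of_pos h0] at hz'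
    have : z - w ≠ 0 := by
      rintro h
      rw [sub_eq_zero] at h
      subst h
      linarith
    exact ((differentiableAt_id.sub_const w).inv this).differentiableWithinAt
  rw [this.circleAverage]
  simp

lemma circleAverage_inv_sub_of_gt {w : ℂ} {r : ℝ} (hw : w ≠ 0) (hr : ‖w‖ < r) :
    Real.circleAverage (fun z => (z - w)⁻¹) 0 r = 0 := by
  have hr0 : 0 < r := (norm_nonneg w).trans_lt hr
  rw [Real.circleAverage_eq_circleIntegral hr0.ne']
  have h1 : EqOn (fun z : ℂ => (z - 0)⁻¹ • (z - w)⁻¹)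
      (fun z => w⁻¹ • ((z - w)⁻¹ - (z - 0)⁻¹)) (sphere 0 r) := by
    intro z hz
    rw [mem_sphere_zero_iff_norm] at hz
    have hz0 : z ≠ 0 := by rintro rfl; simp at hz; linarith
    have hzw : z - w ≠ 0 := by
      intro h; rw [sub_eq_zero] at h; subst h; linarith
    simp only [sub_zero, smul_eq_mul]
    field_simp
    ring
  have c1 : CircleIntegrable (fun z => (z - w)⁻¹) 0 r := by
    rw [circleIntegrable_sub_inv_iff]
    right
    rw [mem_sphere_zero_iff_norm, abs_of_pos hr0]
    exact hr.ne
  have c2 : CircleIntegrable (fun z : ℂ => (z - 0)⁻¹) 0 r := by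
    rw [circleIntegrable_sub_inv_iff]
    right
    rw [mem_sphere_zero_iff_norm, abs_of_pos hr0, norm_zero]
    exact hr0.ne
  rw [circleIntegral.integral_congr hr0.le h1, circleIntegral.integral_smul,
    circleIntegral.integral_sub c1 c2,
    circleIntegral.integral_sub_inv_of_mem_ball (by simpa using hr),
    circleIntegral.integral_sub_inv_of_mem_ball (by simpa using hr0)]
  simp

lemma integral_ball_inv_sub {w : ℂ} {δ : ℝ} (hw : w ≠ 0) (hδ : ‖w‖ < δ) :
    ∫ z in ball (0 : ℂ) δ, (z - w)⁻¹ = -Real.pi * conj w := by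
  have hw0 : 0 < ‖w‖ := norm_pos_iff.2 hw
  have hi : IntegrableOn (fun z => (z - w)⁻¹) (ball 0 δ) :=
    integrableOn_inv_sub measure_ball_lt_top w
  have hmB : Measurable fun z : ℂ => (z - w)⁻¹ := (measurable_id.sub_const w).inv
  rw [← integral_indicator measurableSet_ball,
    integral_eq_integral_circleAverage
      (hmB.indicator measurableSet_ball) (hi.integrable_indicator measurableSet_ball)]
  have key : ∀ᵐ r : ℝ, r ∈ Ioi (0 : ℝ) →
      r • ((2 * Real.pi) • Real.circleAverage ((ball 0 δ).indicator fun z => (z - w)⁻¹) 0 r) =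
      (Ioo 0 ‖w‖).indicator (fun r : ℝ => r • (-(2 * Real.pi) * w⁻¹ : ℂ)) r := by
    filter_upwards [Measure.ae_ne volume ‖w‖] with r hrne hr0
    rw [mem_Ioi] at hr0
    rcases lt_trichotomy r ‖w‖ with h | h | h
    · rw [indicator_of_mem (by exact ⟨hr0, h⟩), Real.circleAverage_congr_sphere
        (f₂ := fun z => (z - w)⁻¹), circleAverage_inv_sub_of_lt hr0 h]
      · simp
      · intro z hz
        rw [mem_sphere_zero_iff_norm, abs_of_pos hr0] at hz
        rw [indicator_of_mem]
        simp; linarith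
    · exact absurd h hrne
    · rw [indicator_of_notMem (by rintro ⟨-, h'⟩; linarith)]
      by_cases hd : r < δ
      · rw [Real.circleAverage_congr_sphere
          (f₂ := fun z => (z - w)⁻¹), circleAverage_inv_sub_of_gt hw h]
        · simp
        · intro z hz
          rw [mem_sphere_zero_iff_norm, abs_of_pos hr0] at hz
          rw [indicator_of_mem]
          simp; linarith
      · rw [Real.circleAverage_congr_sphere (f₂ := fun z => 0)]
        · simp [Real.circleAverage]
        · intro z hz
          rw [mem_sphere_zero_iff_norm, abs_of_pos hr0] at hz
          rw [indicator_of_notMem]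
          simp; linarith
  rw [setIntegral_congr_ae measurableSet_Ioi key, integral_indicator measurableSet_Ioo,
    Measure.restrict_restrict measurableSet_Ioo,
    inter_eq_left.2 (Ioo_subset_Ioi_self : Ioo 0 ‖w‖ ⊆ Ioi 0), integral_smul_const,
    ← integral_Ioc_eq_integral_Ioo, ← intervalIntegral.integral_of_le hw0.le, integral_id,
    Complex.inv_def, Complex.normSq_eq_norm_sq]
  have : (‖w‖ : ℂ) ≠ 0 := by exact_mod_cast hw0.ne'
  simp
  field_simp

lemma differentiableAt_setIntegral_inv_sub {A : Set ℂ} (hA : volume A < ⊤) {w₀ : ℂ} {ρ : ℝ}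
    (hρ : 0 < ρ) (hd : Disjoint A (ball w₀ ρ)) (hm : MeasurableSet A) :
    DifferentiableAt ℂ (fun w => ∫ z in A, (z - w)⁻¹) w₀ := by
  refine ((hasDerivAt_integral_of_dominated_loc_of_deriv_le
    (F := fun w z => (z - w)⁻¹) (F' := fun w z => ((z - w) ^ 2)⁻¹)
    (bound := fun _ => ((ρ / 2) ^ 2)⁻¹) (ball_mem_nhds w₀ (half_pos hρ))
    ?_ ?_ ?_ ?_ ?_ ?_).2).differentiableAt
  · exact Filter.Eventually.of_forall fun w =>
      (measurable_id.sub_const w).inv.aestronglyMeasurable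
  · exact integrableOn_inv_sub hA w₀
  · exact ((measurable_id.sub_const w₀).pow_const 2).inv.aestronglyMeasurable
  · filter_upwards [ae_restrict_mem hm] with z hz w hw
    have h1 : z ∉ ball w₀ ρ := fun h => hd.le_bot ⟨hz, h⟩
    rw [mem_ball, not_lt] at h1
    rw [mem_ball] at hw
    have h2 : ρ / 2 ≤ ‖z - w‖ := by
      rw [← dist_eq_norm]
      linarith [dist_triangle z w w₀]
    rw [norm_inv, norm_pow]
    gcongr
  · exact integrableOn_const hA.ne
  · filter_upwards [ae_restrict_mem hm] with z hz w hw
    have h1 : z ∉ ball w₀ ρ := fun h => hd.le_bot ⟨hz, h⟩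
    rw [mem_ball, not_lt] at h1
    rw [mem_ball] at hw
    have h2 : z - w ≠ 0 := by
      intro h
      rw [sub_eq_zero] at h
      subst h
      linarith
    have := ((hasDerivAt_id w).const_sub z).fun_inv h2
    simpa [div_eq_mul_inv] using this

lemma differentiableOn_conj_add_cauchyTransform {Ω : Set ℂ} (ho : IsOpen Ω) (hA : volume Ω < ⊤) :
    DifferentiableOn ℂ (fun w => conj w + cauchyTransform Ω w / Real.pi) Ω := by
  intro w₀ hw₀
  refine DifferentiableAt.differentiableWithinAt ?_
  obtain ⟨ε, hε, hball⟩ := Metric.isOpen_iff.1 ho w₀ hw₀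
  set c : ℂ := w₀ + (ε / 4 : ℝ) with hc
  have hcw : w₀ - c ≠ 0 := by
    rw [hc]; simp [hε.ne']
  have hdist : dist w₀ c = ε / 4 := by
    rw [hc, dist_eq_norm]; simp [abs_of_pos hε]
  set B := ball c (ε / 2) with hB
  have hBΩ : B ⊆ Ω := by
    refine subset_trans (fun z hz => ?_) hball
    rw [hB, mem_ball] at hz
    rw [mem_ball]
    linarith [dist_triangle z c w₀, dist_comm w₀ c]
  have hw₀B : ball w₀ (ε / 4) ⊆ B := fun z hz => by
    rw [mem_ball] at hz
    rw [hB, mem_ball]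
    linarith [dist_triangle z w₀ c]
  have hdiff : DifferentiableAt ℂ (fun w => ∫ z in Ω \ B, (z - w)⁻¹) w₀ := by
    refine differentiableAt_setIntegral_inv_sub ((measure_mono sdiff_subset).trans_lt hA)
      (by positivity : 0 < ε / 4) ?_ (ho.measurableSet.diff measurableSet_ball)
    exact (disjoint_sdiff_self_left).mono_right hw₀B
  have hev : (fun w => conj w + cauchyTransform Ω w / Real.pi) =ᶠ[nhds w₀]
      fun w => conj c + (∫ z in Ω \ B, (z - w)⁻¹) / Real.pi := by
    have h1 : ∀ᶠ w in nhds w₀, w - c ≠ 0 :=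
      (continuous_id.sub continuous_const).continuousAt.eventually_ne hcw
    have h2 : ∀ᶠ w in nhds w₀, w ∈ ball w₀ (ε / 4) := ball_mem_nhds w₀ (by positivity)
    filter_upwards [h1, h2] with w hw1 hw2
    have hwB := hw₀B hw2
    have hsplit : cauchyTransform Ω w = (∫ z in B, (z - w)⁻¹) + ∫ z in Ω \ B, (z - w)⁻¹ := by
      unfold cauchyTransform
      rw [← setIntegral_union disjoint_sdiff_self_right (ho.measurableSet.diff measurableSet_ball)
        (integrableOn_inv_sub measure_ball_lt_top w)
        ((integrableOn_inv_sub hA w).mono_set sdiff_subset), union_sdiff_cancel hBΩ]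
    have hint : ∫ z in B, (z - w)⁻¹ = -Real.pi * conj (w - c) := by
      rw [← integral_ball_inv_sub (δ := ε / 2) hw1 (by rwa [hB, mem_ball, dist_eq_norm] at hwB),
        ← integral_indicator measurableSet_ball, ← integral_indicator measurableSet_ball,
        ← integral_add_right_eq_self _ c]
      congr 1
      ext z
      simp only [indicator, mem_ball, dist_eq_norm, add_sub_cancel_right, sub_zero]
      rw [sub_sub_eq_add_sub]
    rw [hsplit, hint]
    have : (Real.pi : ℂ) ≠ 0 := by exact_mod_cast Real.pi_ne_zero
    field_simp
    simp only [map_sub]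
    ring
  rw [hev.differentiableAt_iff]
  exact (hdiff.div_const _).const_add _

lemma exists_norm_sub_eq_of_connectedComponentIn {K : Set ℂ} {w : ℂ} (hw : w ∈ K)
    (h : ¬ (connectedComponentIn K w).Subsingleton) :
    ∃ r > 0, ∀ s ∈ Icc (0 : ℝ) r, ∃ k ∈ K, ‖k - w‖ = s := by
  have hwc := mem_connectedComponentIn hw
  obtain ⟨p, hp, hpw⟩ : ∃ p ∈ connectedComponentIn K w, p ≠ w := by
    by_contra! hcon
    exact h fun a ha b hb => (hcon a ha).trans (hcon b hb).symm
  refine ⟨‖p - w‖, norm_pos_iff.2 (sub_ne_zero.2 hpw), fun s hs => ?_⟩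
  have hpre := isPreconnected_connectedComponentIn (F := K) (x := w)
  obtain ⟨k, hk, rfl⟩ := hpre.intermediate_value hwc hp
    (f := fun z => ‖z - w‖) (by fun_prop) (by simpa using hs)
  exact ⟨k, connectedComponentIn_subset _ _ hk, rfl⟩

lemma exists_measurable_norm_sub_eq {K : Set ℂ} (hK : IsClosed K) {w : ℂ} (hw : w ∈ K) {r : ℝ}
    (h : ∀ s ∈ Icc (0 : ℝ) r, ∃ k ∈ K, ‖k - w‖ = s) :
    ∃ κ : ℝ → ℂ, Measurable κ ∧ (∀ s, κ s ∈ K) ∧ ∀ s ∈ Icc (0 : ℝ) r, ‖κ s - w‖ = s := by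
  classical
  have hcm : Continuous fun p : ℝ × ℝ => circleMap w p.1 p.2 := by
    unfold circleMap; fun_prop
  set A : ℝ → Set ℝ := fun s => {θ | θ ∈ Icc 0 (2 * Real.pi) ∧ circleMap w s θ ∈ K}
  have hAc : ∀ s, IsCompact (A s) := fun s =>
    isCompact_Icc.inter_right (hK.preimage (continuous_circleMap w s))
  have hAne : ∀ s ∈ Icc (0 : ℝ) r, (A s).Nonempty := by
    intro s hs
    obtain ⟨k, hk, hks⟩ := h s hs
    have : k ∈ circleMap w s '' Ioc 0 (2 * Real.pi) := by
      rw [image_circleMap_Ioc, abs_of_nonneg hs.1]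
      simpa [dist_eq_norm] using hks
    obtain ⟨θ, hθ, rfl⟩ := this
    exact ⟨θ, Ioc_subset_Icc_self hθ, hk⟩
  set θ : ℝ → ℝ := fun s => if s ∈ Icc (0 : ℝ) r then sInf (A s) else 0
  have hθA : ∀ s ∈ Icc (0 : ℝ) r, θ s ∈ A s := by
    intro s hs
    simp only [θ, if_pos hs]
    exact (hAc s).sInf_mem (hAne s hs)
  have hθm : Measurable θ := by
    refine measurable_of_Iic fun a => ?_
    have hproj : IsCompact (Prod.fst '' ((Icc (0 : ℝ) r ×ˢ Icc 0 (2 * Real.pi)) ∩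
        {p : ℝ × ℝ | p.2 ≤ a ∧ circleMap w p.1 p.2 ∈ K})) := by
      refine IsCompact.image ((isCompact_Icc.prod isCompact_Icc).inter_right ?_) continuous_fst
      exact (isClosed_le continuous_snd continuous_const).inter (hK.preimage hcm)
    have heq : θ ⁻¹' Iic a = (Prod.fst '' ((Icc (0 : ℝ) r ×ˢ Icc 0 (2 * Real.pi)) ∩
        {p : ℝ × ℝ | p.2 ≤ a ∧ circleMap w p.1 p.2 ∈ K})) ∪ ((Icc (0 : ℝ) r)ᶜ ∩ {_s | 0 ≤ a}) := by
      ext s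
      by_cases hs : s ∈ Icc (0 : ℝ) r
      · constructor
        · intro h'
          exact Or.inl ⟨(s, θ s), ⟨⟨hs, (hθA s hs).1⟩, h', (hθA s hs).2⟩, rfl⟩
        · rintro (⟨⟨s', t⟩, ⟨⟨-, h1⟩, h2, h3⟩, rfl⟩ | h')
          · simp only [mem_preimage, mem_Iic, θ, if_pos hs]
            exact (csInf_le (hAc s').bddBelow ⟨h1, h3⟩).trans h2
          · exact absurd hs h'.1
      · constructor
        · intro h'
          simp only [mem_preimage, mem_Iic, θ, if_neg hs] at h'
          exact Or.inr ⟨hs, h'⟩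
        · rintro (⟨⟨s', t⟩, ⟨⟨h0, h1⟩, h2, h3⟩, rfl⟩ | h')
          · exact absurd h0 hs
          · simp only [mem_preimage, mem_Iic, θ, if_neg hs]
            exact h'.2
    rw [heq]
    exact hproj.measurableSet.union (measurableSet_Icc.compl.inter (.const _))
  refine ⟨fun s => if s ∈ Icc (0 : ℝ) r then circleMap w s (θ s) else w, ?_, ?_, ?_⟩
  · exact Measurable.ite measurableSet_Icc (hcm.measurable.comp (measurable_id.prodMk hθm))
      measurable_const
  · intro s
    dsimp only
    split_ifs with hs
    · exact (hθA s hs).2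
    · exact hw
  · intro s hs
    simp only [if_pos hs]
    rw [circleMap_sub_center, norm_circleMap_zero, abs_of_nonneg hs.1]

/-- The values at `z` of the derivative of order `k` of the Cauchy kernel averaged along `κ`. -/
def cauchyAverage (κ : ℝ → ℂ) (r : ℝ) (k : ℕ) (z : ℂ) : ℂ :=
  ∫ s in Ioc 0 r, ((-1) ^ k * k.factorial * ((z - κ s) ^ (k + 1))⁻¹ : ℂ)

lemma integrableOn_inv_sub_pow {Ω : Set ℂ} (ho : IsOpen Ω) {κ : ℝ → ℂ}
    (hκ : Measurable κ) (hκΩ : ∀ s, κ s ∈ Ωᶜ) (r : ℝ) (k : ℕ) {z : ℂ} (hz : z ∈ Ω) :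
    IntegrableOn (fun s => ((-1) ^ k * k.factorial * ((z - κ s) ^ (k + 1))⁻¹ : ℂ)) (Ioc 0 r) := by
  obtain ⟨ε, hε, hball⟩ := Metric.isOpen_iff.1 ho z hz
  have hm : Measurable fun s => ((z - κ s) ^ (k + 1))⁻¹ := ((hκ.const_sub z).pow_const _).inv
  refine Integrable.const_mul ?_ _
  refine Measure.integrableOn_of_bounded (M := ((ε) ^ (k + 1))⁻¹) (by simp) hm.aestronglyMeasurable
    (ae_of_all _ fun s => ?_)
  have : ε ≤ ‖z - κ s‖ := by
    by_contra! h
    exact hκΩ s (hball (by rwa [mem_ball, dist_comm, dist_eq_norm]))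
  rw [norm_inv, norm_pow]
  gcongr

lemma hasDerivAt_cauchyAverage {Ω : Set ℂ} (ho : IsOpen Ω) {κ : ℝ → ℂ}
    (hκ : Measurable κ) (hκΩ : ∀ s, κ s ∈ Ωᶜ) (r : ℝ) (k : ℕ) {z : ℂ} (hz : z ∈ Ω) :
    HasDerivAt (cauchyAverage κ r k) (cauchyAverage κ r (k + 1) z) z := by
  obtain ⟨ε, hε, hball⟩ := Metric.isOpen_iff.1 ho z hz
  have hlow : ∀ s, ∀ x ∈ ball z (ε / 2), ε / 2 ≤ ‖x - κ s‖ := by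
    intro s x hx
    by_contra! h
    rw [mem_ball, dist_eq_norm] at hx
    refine hκΩ s (hball ?_)
    rw [mem_ball, dist_eq_norm]
    calc ‖κ s - z‖ = ‖(x - z) - (x - κ s)‖ := by congr 1; ring
      _ ≤ ‖x - z‖ + ‖x - κ s‖ := norm_sub_le _ _
      _ < ε := by linarith
  have hm : ∀ (k : ℕ) (x : ℂ),
      Measurable fun s => ((-1) ^ k * k.factorial * ((x - κ s) ^ (k + 1))⁻¹ : ℂ) := fun k x =>
    (((hκ.const_sub x).pow_const _).inv).const_mul _
  refine (hasDerivAt_integral_of_dominated_loc_of_deriv_le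
    (F := fun x s => ((-1) ^ k * k.factorial * ((x - κ s) ^ (k + 1))⁻¹ : ℂ))
    (F' := fun x s => ((-1) ^ (k + 1) * (k + 1).factorial * ((x - κ s) ^ (k + 1 + 1))⁻¹ : ℂ))
    (bound := fun _ => (k + 1).factorial * ((ε / 2) ^ (k + 1 + 1))⁻¹)
    (ball_mem_nhds z (half_pos hε)) ?_ ?_ ?_ ?_ ?_ ?_).2
  · exact Filter.Eventually.of_forall fun x => (hm k x).aestronglyMeasurable
  · exact integrableOn_inv_sub_pow ho hκ hκΩ r k hz
  · exact (hm (k + 1) z).aestronglyMeasurable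
  · refine ae_of_all _ fun s x hx => ?_
    have := hlow s x hx
    rw [norm_mul, norm_mul, norm_inv, norm_pow, norm_pow]
    simp only [norm_neg, norm_one, one_pow, one_mul, Complex.norm_natCast]
    gcongr
  · exact integrableOn_const (by simp)
  · refine ae_of_all _ fun s x hx => ?_
    have hne : x - κ s ≠ 0 := by
      rw [← norm_pos_iff]
      linarith [hlow s x hx]
    have h1 := (((hasDerivAt_id x).sub_const (κ s)).fun_pow (k + 1)).fun_inv (pow_ne_zero _ hne)
    refine (h1.const_mul ((-1) ^ k * k.factorial : ℂ)).congr_deriv ?_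
    simp only [id, Nat.factorial_succ, pow_succ]
    push_cast
    field_simp

lemma iteratedDerivWithin_cauchyAverage {Ω : Set ℂ} (ho : IsOpen Ω) {κ : ℝ → ℂ}
    (hκ : Measurable κ) (hκΩ : ∀ s, κ s ∈ Ωᶜ) (r : ℝ) (k : ℕ) {z : ℂ} (hz : z ∈ Ω) :
    iteratedDerivWithin k (cauchyAverage κ r 0) Ω z = cauchyAverage κ r k z := by
  induction k generalizing z with
  | zero => simp
  | succ k ih =>
    rw [iteratedDerivWithin_succ, derivWithin_congr (fun x hx => ih hx) (ih hz),
      derivWithin_of_isOpen ho hz]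
    exact (hasDerivAt_cauchyAverage ho hκ hκΩ r k hz).deriv

lemma exists_lintegral_inv_sqrt_abs_sub_le (r : ℝ) :
    ∃ C : ENNReal, C ≠ ⊤ ∧ ∀ t : ℝ, ∫⁻ s in Ioc 0 r, ENNReal.ofReal (√|s - t|)⁻¹ ≤ C := by
  have hm : Measurable fun u : ℝ => ENNReal.ofReal (√|u|)⁻¹ := by fun_prop
  have hfin : ∫⁻ u in Icc (-1 : ℝ) 1, ENNReal.ofReal (√|u|)⁻¹ ≠ ⊤ := by
    have h1 : IntegrableOn (fun y : ℝ => (√|y|)⁻¹) (Icc 0 1) := by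
      have := (intervalIntegral.intervalIntegrable_rpow' (a := 0) (b := 1) (r := -(1/2))
        (by norm_num)).1
      rw [← integrableOn_Icc_iff_integrableOn_Ioc] at this
      refine this.congr_fun (fun y hy => ?_) measurableSet_Icc
      simp only
      rw [abs_of_nonneg hy.1, Real.rpow_neg hy.1, ← Real.sqrt_eq_rpow]
    have h2 : IntegrableOn (fun y : ℝ => (√|y|)⁻¹) (Icc (-1) 0) := by
      have := h1.comp_neg
      simpa using this
    have h3 := h2.union h1
    rw [Icc_union_Icc_eq_Icc (by norm_num) (by norm_num)] at h3
    exact h3.lintegral_lt_top.ne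
  refine ⟨volume (Ioc 0 r) + ∫⁻ u in Icc (-1 : ℝ) 1, ENNReal.ofReal (√|u|)⁻¹,
    ENNReal.add_ne_top.2 ⟨by simp, hfin⟩, fun t => ?_⟩
  calc ∫⁻ s in Ioc 0 r, ENNReal.ofReal (√|s - t|)⁻¹
      ≤ ∫⁻ s in Ioc 0 r, (1 + (Icc (-1 : ℝ) 1).indicator
          (fun u => ENNReal.ofReal (√|u|)⁻¹) (s - t)) := by
        refine lintegral_mono fun s => ?_
        by_cases h : s - t ∈ Icc (-1 : ℝ) 1
        · rw [indicator_of_mem h]; exact le_add_self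
        · rw [indicator_of_notMem h, add_zero, ← ENNReal.ofReal_one]
          refine ENNReal.ofReal_le_ofReal (inv_le_one_of_one_le₀ ?_)
          rw [Real.one_le_sqrt]
          rw [mem_Icc, ← abs_le, not_le] at h
          exact h.le
    _ = volume (Ioc 0 r) + ∫⁻ s in Ioc 0 r, (Icc (-1 : ℝ) 1).indicator
          (fun u => ENNReal.ofReal (√|u|)⁻¹) (s - t) := by
        rw [lintegral_add_left measurable_const]; simp
    _ ≤ volume (Ioc 0 r) + ∫⁻ s, (Icc (-1 : ℝ) 1).indicator
          (fun u => ENNReal.ofReal (√|u|)⁻¹) (s - t) := by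
        gcongr; exact Measure.restrict_le_self
    _ = _ := by
        rw [lintegral_sub_right_eq_self (fun s => (Icc (-1 : ℝ) 1).indicator
          (fun u => ENNReal.ofReal (√|u|)⁻¹) s), lintegral_indicator measurableSet_Icc]

lemma cauchyAverage_zero (κ : ℝ → ℂ) (r : ℝ) :
    cauchyAverage κ r 0 = fun z => ∫ s in Ioc 0 r, (z - κ s)⁻¹ := by
  ext z; simp [cauchyAverage]

lemma enorm_cauchyAverage_zero_sq_le {κ : ℝ → ℂ} (hκ : Measurable κ) {r : ℝ} {w : ℂ}
    (hκw : ∀ s ∈ Ioc 0 r, ‖κ s - w‖ = s) (z : ℂ) :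
    ‖cauchyAverage κ r 0 z‖ₑ ^ 2 ≤ (∫⁻ s in Ioc 0 r, ENNReal.ofReal (√|s - ‖z - w‖|)⁻¹) *
      ∫⁻ s in Ioc 0 r, ENNReal.ofReal (rieszKernel (z - κ s)) := by
  have hfm : Measurable fun s => ENNReal.ofReal (√‖z - κ s‖)⁻¹ := by fun_prop
  have hgm : Measurable fun s => ENNReal.ofReal (rieszKernel (z - κ s)) :=
    (measurable_rieszKernel.comp (hκ.const_sub z)).ennreal_ofReal
  have hle : ∫⁻ s in Ioc 0 r, ENNReal.ofReal (√‖z - κ s‖)⁻¹ ≤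
      ∫⁻ s in Ioc 0 r, ENNReal.ofReal (√|s - ‖z - w‖|)⁻¹ := by
    have hnull : ∀ᵐ s : ℝ, s ≠ ‖z - w‖ := Measure.ae_ne volume _
    refine setLIntegral_mono_ae' measurableSet_Ioc ?_
    filter_upwards [hnull] with s hs0 hs
    have h1 : 0 < |s - ‖z - w‖| := abs_pos.2 (sub_ne_zero.2 hs0)
    have h2 : |s - ‖z - w‖| ≤ ‖z - κ s‖ := by
      have := abs_norm_sub_norm_le (κ s - w) (z - w)
      rw [hκw s hs] at this
      rwa [sub_sub_sub_cancel_right, norm_sub_rev (κ s)] at this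
    gcongr
  have hpt : ∀ s, ‖(z - κ s)⁻¹‖ₑ = ENNReal.ofReal (√‖z - κ s‖)⁻¹ ^ (1 / 2 : ℝ) *
      ENNReal.ofReal (rieszKernel (z - κ s)) ^ (1 / 2 : ℝ) := by
    intro s
    rw [← ENNReal.mul_rpow_of_nonneg _ _ (by norm_num), ← ENNReal.ofReal_mul (by positivity),
      ENNReal.ofReal_rpow_of_nonneg (mul_nonneg (by positivity) (rieszKernel_nonneg _))
        (by norm_num),
      ← Real.sqrt_eq_rpow, ← ofReal_norm, norm_inv]
    congr 1
    have : (√‖z - κ s‖)⁻¹ * rieszKernel (z - κ s) = (‖z - κ s‖⁻¹) ^ 2 := by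
      unfold rieszKernel
      nth_rw 3 [← Real.sq_sqrt (norm_nonneg (z - κ s))]
      ring
    rw [this, Real.sqrt_sq (by positivity)]
  have hsq : ∀ a : ENNReal, (a ^ (1 / 2 : ℝ)) ^ 2 = a := fun a => by
    rw [← ENNReal.rpow_natCast, ← ENNReal.rpow_mul]; norm_num
  have h1 : ‖cauchyAverage κ r 0 z‖ₑ ≤
      (∫⁻ s in Ioc 0 r, ENNReal.ofReal (√|s - ‖z - w‖|)⁻¹) ^ (1 / 2 : ℝ) *
        (∫⁻ s in Ioc 0 r, ENNReal.ofReal (rieszKernel (z - κ s))) ^ (1 / 2 : ℝ) := by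
    rw [cauchyAverage_zero]
    refine (enorm_integral_le_lintegral_enorm _).trans ?_
    simp_rw [hpt]
    refine (ENNReal.lintegral_mul_norm_pow_le hfm.aemeasurable hgm.aemeasurable (by norm_num)
      (by norm_num) (by norm_num)).trans ?_
    gcongr
  refine (pow_le_pow_left₀ zero_le h1 2).trans ?_
  rw [mul_pow, hsq, hsq]

lemma bergmanFun_cauchyAverage {Ω : Set ℂ} (ho : IsOpen Ω) (hA : volume Ω < ⊤) {κ : ℝ → ℂ}
    (hκ : Measurable κ) (hκΩ : ∀ s, κ s ∈ Ωᶜ) {r : ℝ} {w : ℂ}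
    (hκw : ∀ s ∈ Ioc 0 r, ‖κ s - w‖ = s) : BergmanFun Ω (cauchyAverage κ r 0) := by
  have hd : DifferentiableOn ℂ (cauchyAverage κ r 0) Ω := fun z hz =>
    (hasDerivAt_cauchyAverage ho hκ hκΩ r 0 hz).differentiableAt.differentiableWithinAt
  obtain ⟨C, hC, hCb⟩ := exists_lintegral_inv_sqrt_abs_sub_le r
  obtain ⟨M, hM0, hM⟩ := exists_rieszKernel_bound hA
  refine ⟨hd, (hd.continuousOn.norm.pow 2).aestronglyMeasurable ho.measurableSet, ?_⟩
  rw [HasFiniteIntegral]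
  have hm2 : Measurable (Function.uncurry fun (z : ℂ) (s : ℝ) =>
      ENNReal.ofReal (rieszKernel (z - κ s))) :=
    (measurable_rieszKernel.comp (measurable_fst.sub (hκ.comp measurable_snd))).ennreal_ofReal
  calc ∫⁻ z in Ω, ‖‖cauchyAverage κ r 0 z‖ ^ 2‖ₑ
      = ∫⁻ z in Ω, ‖cauchyAverage κ r 0 z‖ₑ ^ 2 := by simp
    _ ≤ ∫⁻ z in Ω, C * ∫⁻ s in Ioc 0 r, ENNReal.ofReal (rieszKernel (z - κ s)) := by
        refine lintegral_mono fun z => (enorm_cauchyAverage_zero_sq_le hκ hκw z).trans ?_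
        gcongr
        exact hCb _
    _ = C * ∫⁻ s in Ioc 0 r, ∫⁻ z in Ω, ENNReal.ofReal (rieszKernel (z - κ s)) := by
        rw [lintegral_const_mul' _ _ hC, lintegral_lintegral_swap hm2.aemeasurable]
    _ ≤ C * ∫⁻ s in Ioc 0 r, ENNReal.ofReal M := by
        gcongr with s
        rw [← ofReal_integral_eq_lintegral_ofReal (hM _).1
          (ae_of_all _ fun _ => rieszKernel_nonneg _)]
        exact ENNReal.ofReal_le_ofReal (hM _).2
    _ < ⊤ := by
        refine ENNReal.mul_lt_top hC.lt_top ?_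
        simp [ENNReal.mul_lt_top]

lemma setIntegral_cauchyAverage {Ω : Set ℂ} (hA : volume Ω < ⊤) {κ : ℝ → ℂ}
    (hκ : Measurable κ) (r : ℝ) :
    ∫ z in Ω, cauchyAverage κ r 0 z = ∫ s in Ioc 0 r, cauchyTransform Ω (κ s) := by
  obtain ⟨M, hM0, hM⟩ := exists_norm_cauchyTransform_le hA
  rw [cauchyAverage_zero]
  unfold cauchyTransform
  have : IsFiniteMeasure (volume.restrict Ω) := ⟨by simpa using hA⟩
  refine integral_integral_swap ?_
  have hm : Measurable (Function.uncurry fun (z : ℂ) (s : ℝ) => (z - κ s)⁻¹) :=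
    (measurable_fst.sub (hκ.comp measurable_snd)).inv
  rw [integrable_prod_iff' hm.aestronglyMeasurable]
  refine ⟨ae_of_all _ fun s => integrableOn_inv_sub hA (κ s), ?_⟩
  refine Measure.integrableOn_of_bounded (M := M) (by simp) ?_ (ae_of_all _ fun s => ?_)
  · exact (hm.norm.stronglyMeasurable.integral_prod_left
      (μ := volume.restrict Ω)).aestronglyMeasurable
  · rw [Real.norm_of_nonneg (integral_nonneg fun _ => norm_nonneg _)]
    exact hM (κ s)

/-- The quadrature functional with nodes `w` and coefficients `c`, applied to the Cauchy kernel
with pole `ζ`. -/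
def nodeKernel {N : ℕ} (w : Fin N → ℂ) (n : Fin N → ℕ) (c : Fin N → ℕ → ℂ) (ζ : ℂ) : ℂ :=
  ∑ j, ∑ k ∈ Finset.range (n j + 1), c j k * ((-1) ^ k * k.factorial * ((w j - ζ) ^ (k + 1))⁻¹)

lemma differentiableAt_nodeKernel {N : ℕ} {w : Fin N → ℂ} {n : Fin N → ℕ} {c : Fin N → ℕ → ℂ}
    {ζ : ℂ} (h : ∀ j, w j ≠ ζ) : DifferentiableAt ℂ (nodeKernel w n c) ζ := by
  unfold nodeKernel
  have : ∀ j, ∀ k : ℕ, (w j - ζ) ^ (k + 1) ≠ 0 := fun j k => pow_ne_zero _ (sub_ne_zero.2 (h j))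
  fun_prop (disch := simp_all)

lemma cauchyTransform_eq_nodeKernel {Ω : Set ℂ} (ho : IsOpen Ω) (hA : volume Ω < ⊤)
    {N : ℕ} {w : Fin N → ℂ} {n : Fin N → ℕ} {c : Fin N → ℕ → ℂ} (hw : ∀ j, w j ∈ Ω)
    (hquad : ∀ f : ℂ → ℂ, BergmanFun Ω f → (∫ z in Ω, f z) =
        ∑ j, ∑ k ∈ Finset.range (n j + 1), c j k * iteratedDerivWithin k f Ω (w j))
    {ζ : ℂ} (hζ : ζ ∈ Ωᶜ) (hcomp : ¬ (connectedComponentIn Ωᶜ ζ).Subsingleton) :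
    cauchyTransform Ω ζ = nodeKernel w n c ζ := by
  obtain ⟨r, hr, hex⟩ := exists_norm_sub_eq_of_connectedComponentIn hζ hcomp
  obtain ⟨κ, hκ, hκΩ, hκζ⟩ := exists_measurable_norm_sub_eq ho.isClosed_compl hζ hex
  set E : ℂ → ℂ := fun ζ => cauchyTransform Ω ζ - nodeKernel w n c ζ with hE
  have hEc : ContinuousAt E ζ := (continuous_cauchyTransform hA).continuousAt.sub
    (differentiableAt_nodeKernel fun j (h : w j = ζ) => hζ (h ▸ hw j)).continuousAt
  have hzero : ∀ r' ≤ r, IntegrableOn (fun s => E (κ s)) (Ioc 0 r') ∧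
      ∫ s in Ioc 0 r', E (κ s) = 0 := by
    intro r' hr'
    have hB := bergmanFun_cauchyAverage ho hA hκ hκΩ (r := r') (w := ζ)
      fun s hs => hκζ s ⟨hs.1.le, hs.2.trans hr'⟩
    have h1 := hquad _ hB
    rw [setIntegral_cauchyAverage hA hκ] at h1
    obtain ⟨M, hM0, hM⟩ := exists_norm_cauchyTransform_le hA
    have hi1 : IntegrableOn (fun s => cauchyTransform Ω (κ s)) (Ioc 0 r') :=
      Measure.integrableOn_of_bounded (M := M) (by simp)
        ((continuous_cauchyTransform hA).measurable.comp hκ).aestronglyMeasurable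
        (ae_of_all _ fun s => (norm_integral_le_integral_norm _).trans (hM _))
    have hi2 : ∀ j k, IntegrableOn
        (fun s => c j k * ((-1) ^ k * k.factorial * ((w j - κ s) ^ (k + 1))⁻¹)) (Ioc 0 r') :=
      fun j k => (integrableOn_inv_sub_pow ho hκ hκΩ r' k (hw j)).const_mul _
    have hi3 : IntegrableOn (fun s => nodeKernel w n c (κ s)) (Ioc 0 r') :=
      integrable_finsetSum _ fun j _ => integrable_finsetSum _ fun k _ => hi2 j k
    refine ⟨hi1.sub hi3, ?_⟩
    simp only [hE]
    rw [integral_sub hi1 hi3, h1, sub_eq_zero]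
    unfold nodeKernel
    rw [integral_finsetSum _ fun j _ => integrable_finsetSum _ fun k _ => hi2 j k]
    refine Finset.sum_congr rfl fun j _ => ?_
    rw [integral_finsetSum _ fun k _ => hi2 j k]
    refine Finset.sum_congr rfl fun k _ => ?_
    rw [integral_const_mul, iteratedDerivWithin_cauchyAverage ho hκ hκΩ r' k (hw j)]
    rfl
  rw [← sub_eq_zero]
  by_contra hne
  change E ζ ≠ 0 at hne
  have hpos : 0 < ‖E ζ‖ / 2 := half_pos (norm_pos_iff.2 hne)
  obtain ⟨δ, hδ, hδE⟩ := Metric.continuousAt_iff.1 hEc _ hpos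
  set r' := min r (δ / 2) with hr'
  have hr'0 : 0 < r' := lt_min hr (half_pos hδ)
  obtain ⟨hi, h0⟩ := hzero r' (min_le_left _ _)
  have hbd : ‖∫ s in Ioc 0 r', (E (κ s) - E ζ)‖ ≤ ‖E ζ‖ / 2 * volume.real (Ioc 0 r') := by
    refine norm_setIntegral_le_of_norm_le_const (by simp) fun s hs => ?_
    rw [← dist_eq_norm]
    refine (hδE ?_).le
    rw [dist_eq_norm, hκζ s ⟨hs.1.le, hs.2.trans (min_le_left _ _)⟩]
    linarith [hs.2.trans (min_le_right r (δ / 2))]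
  rw [integral_sub hi (integrableOn_const (by simp)), h0, setIntegral_const, zero_sub, norm_neg,
    norm_smul, Real.volume_real_Ioc_of_le hr'0.le, sub_zero, Real.norm_of_nonneg hr'0.le] at hbd
  nlinarith

lemma isBounded_of_schwarz {Ω : Set ℂ} (ho : IsOpen Ω) {e : ℂ → ℂ} {ρ ε : ℝ}
    (hc : ContinuousOn e {z | ρ < ‖z‖})
    (hd : DifferentiableOn ℂ (fun z => conj z + e z) (Ω ∩ {z | ρ < ‖z‖}))
    (h0 : ∀ z ∉ Ω, e z = 0) (hε : ∀ z, ρ < ‖z‖ → ‖e z‖ ≤ ε) : Bornology.IsBounded Ω := by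
  by_contra hunb
  set r := |ε| + 1 with hr
  have hr0 : 0 < r := by positivity
  obtain ⟨z₀, hz₀, hz₀n⟩ : ∃ z ∈ Ω, ρ + r < ‖z‖ := by
    by_contra! hcon
    exact hunb (isBounded_iff_forall_norm_le.2 ⟨_, hcon⟩)
  set U := Ω ∩ ball z₀ r with hU
  have hUo : IsOpen U := ho.inter isOpen_ball
  have hcl : closure U ⊆ closedBall z₀ r :=
    (closure_mono inter_subset_right).trans closure_ball_subset_closedBall
  have hfar : closedBall z₀ r ⊆ {z | ρ < ‖z‖} := fun z hz => by
    rw [mem_closedBall, dist_eq_norm] at hz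
    rw [mem_ofPred_eq]
    have := norm_sub_norm_le z₀ z
    rw [norm_sub_rev] at this
    linarith
  set G : ℂ → ℂ := fun z => exp (-((z - z₀) * ((conj z + e z) - conj z₀))) with hG
  have hGd : DiffContOnCl ℂ G U := by
    constructor
    · have hUs : U ⊆ Ω ∩ {z | ρ < ‖z‖} := fun z hz => ⟨hz.1, hfar (ball_subset_closedBall hz.2)⟩
      have := hd.mono hUs
      fun_prop
    · have := hc.mono (hcl.trans hfar)
      have h2 : Continuous (conj : ℂ → ℂ) := continuous_conj
      fun_prop
  have hnorm : ∀ z, ‖G z‖ = Real.exp (-(‖z - z₀‖ ^ 2 + ((z - z₀) * e z).re)) := by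
    intro z
    rw [hG, Complex.norm_exp, neg_re]
    congr 2
    rw [show (z - z₀) * ((conj z + e z) - conj z₀) = (z - z₀) * conj (z - z₀) + (z - z₀) * e z by
      rw [map_sub]; ring, mul_conj, add_re, ofReal_re, normSq_eq_norm_sq]
  obtain ⟨z, hz, hmax⟩ := Complex.exists_mem_frontier_isMaxOn_norm
    (isBounded_ball.subset inter_subset_right) ⟨z₀, hz₀, mem_ball_self hr0⟩ hGd
  have hz₀U : z₀ ∈ closure U := subset_closure ⟨hz₀, mem_ball_self hr0⟩
  have h1 := hmax hz₀U
  rw [mem_ofPred_eq, Function.comp, Function.comp, hnorm, hnorm, Real.exp_le_exp] at h1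
  simp only [sub_self, norm_zero, zero_mul, zero_re] at h1
  rw [hUo.frontier_eq] at hz
  have hzb := hcl hz.1
  by_cases hzΩ : z ∈ Ω
  · have hzr : ‖z - z₀‖ = r := by
      refine le_antisymm (by simpa [dist_eq_norm] using hzb) ?_
      by_contra! hlt
      exact hz.2 ⟨hzΩ, by simpa [dist_eq_norm] using hlt⟩
    have h2 : |((z - z₀) * e z).re| ≤ r * |ε| := by
      refine (abs_re_le_norm _).trans ?_
      rw [norm_mul, hzr]
      gcongr
      exact (hε z (hfar hzb)).trans (le_abs_self _)
    rw [hzr] at h1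
    have := (abs_le.1 h2).1
    nlinarith
  · rw [h0 z hzΩ, mul_zero, zero_re] at h1
    have : z - z₀ = 0 := by
      rw [← norm_eq_zero]
      nlinarith [norm_nonneg (z - z₀)]
    rw [sub_eq_zero] at this
    exact hzΩ (this ▸ hz₀)

lemma eq_of_forall_re_le {Ω : Set ℂ} (ho : IsOpen Ω) (hΩ : IsConnected Ω) {F : ℂ → ℂ}
    (hF : DifferentiableOn ℂ F Ω) {m : ℂ} (hm : m ∈ Ω) (hmax : ∀ z ∈ Ω, (F z).re ≤ (F m).re) :
    ∀ a ∈ Ω, ∀ b ∈ Ω, F a = F b := by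
  have hmax' : IsMaxOn (norm ∘ fun z => exp (F z)) Ω m := fun z hz => by
    simpa [Complex.norm_exp] using hmax z hz
  have hconst := Complex.eqOn_of_isPreconnected_of_isMaxOn_norm hΩ.isPreconnected ho
    hF.cexp hm hmax'
  have hder : ∀ z ∈ Ω, deriv F z = 0 := by
    intro z hz
    have h1 : HasDerivAt (fun z => exp (F z)) 0 z :=
      (hasDerivAt_const z (exp (F m))).congr_of_eventuallyEq
        (Filter.eventuallyEq_of_mem (ho.mem_nhds hz) hconst)
    have h2 := h1.unique (hF.differentiableAt (ho.mem_nhds hz)).hasDerivAt.cexp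
    exact (mul_eq_zero.1 h2.symm).resolve_left (exp_ne_zero _)
  intro a ha b hb
  exact ho.is_const_of_deriv_eq_zero hΩ.isPreconnected hF hder ha hb

lemma eq_of_re_small {Ω : Set ℂ} (ho : IsOpen Ω) (hΩ : IsConnected Ω) {F : ℂ → ℂ}
    (hF : DifferentiableOn ℂ F Ω)
    (hε : ∀ ε > 0, ∃ K ⊆ Ω, IsCompact K ∧ ∀ z ∈ Ω \ K, |(F z).re| ≤ ε) :
    ∀ a ∈ Ω, ∀ b ∈ Ω, F a = F b := by
  have hpos : ∀ F : ℂ → ℂ, DifferentiableOn ℂ F Ω →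
      (∀ ε > 0, ∃ K ⊆ Ω, IsCompact K ∧ ∀ z ∈ Ω \ K, |(F z).re| ≤ ε) →
      (∃ a ∈ Ω, 0 < (F a).re) → ∀ a ∈ Ω, ∀ b ∈ Ω, F a = F b := by
    intro F hF hFε ⟨a, ha, hpos⟩
    obtain ⟨K, hKΩ, hK, hKε⟩ := hFε _ (half_pos hpos)
    have haK : a ∈ K := by
      by_contra haK
      have := (le_abs_self _).trans (hKε a ⟨ha, haK⟩)
      linarith
    obtain ⟨m, hm, hmax⟩ := hK.exists_isMaxOn ⟨a, haK⟩
      (continuous_re.comp_continuousOn (hF.continuousOn.mono hKΩ))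
    refine eq_of_forall_re_le ho hΩ hF (hKΩ hm) fun z hz => ?_
    by_cases hzK : z ∈ K
    · exact hmax hzK
    · have h1 := (le_abs_self _).trans (hKε z ⟨hz, hzK⟩)
      have h2 : (F a).re ≤ (F m).re := hmax haK
      linarith
  by_cases h1 : ∃ a ∈ Ω, 0 < (F a).re
  · exact hpos F hF hε h1
  push Not at h1
  by_cases h2 : ∃ m ∈ Ω, (F m).re = 0
  · obtain ⟨m, hm, h0⟩ := h2
    exact eq_of_forall_re_le ho hΩ hF hm fun z hz => (h1 z hz).trans_eq h0.symm
  push Not at h2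
  obtain ⟨m, hm⟩ := hΩ.nonempty
  intro a ha b hb
  refine neg_injective (hpos (fun z => -F z) hF.neg (by simpa using hε) ⟨m, hm, ?_⟩ a ha b hb)
  rw [neg_re, neg_pos]
  exact (h1 m hm).lt_of_ne (h2 m hm)

/-- A holomorphic function on a connected open set whose conjugate is asymptotic at the boundary
to a holomorphic function is constant. -/
lemma eq_of_conj_sub_small {Ω : Set ℂ} (ho : IsOpen Ω) (hΩ : IsConnected Ω) {G g : ℂ → ℂ}
    (hG : DifferentiableOn ℂ G Ω) (hg : DifferentiableOn ℂ g Ω)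
    (h : ∀ ε > 0, ∃ K ⊆ Ω, IsCompact K ∧ ∀ z ∈ Ω \ K, ‖conj (G z) - g z‖ ≤ ε) :
    ∀ a ∈ Ω, ∀ b ∈ Ω, G a = G b := by
  have hadd := eq_of_re_small ho hΩ (F := fun z => I * (G z + g z)) (by fun_prop) (by
    intro ε hε
    obtain ⟨K, hKΩ, hK, hKε⟩ := h ε hε
    refine ⟨K, hKΩ, hK, fun z hz => ?_⟩
    refine le_trans ?_ (hKε z hz)
    refine le_trans (le_of_eq ?_) (abs_im_le_norm _)
    simp only [I_mul_re, add_im, sub_im, conj_im]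
    congr 1; ring)
  have hsub := eq_of_re_small ho hΩ (F := fun z => G z - g z) (by fun_prop) (by
    intro ε hε
    obtain ⟨K, hKΩ, hK, hKε⟩ := h ε hε
    refine ⟨K, hKΩ, hK, fun z hz => ?_⟩
    refine le_trans ?_ (hKε z hz)
    refine le_trans (le_of_eq ?_) (abs_re_le_norm _)
    simp)
  intro a ha b hb
  have h1 := mul_left_cancel₀ I_ne_zero (hadd a ha b hb)
  have h2 := hsub a ha b hb
  linear_combination (h1 + h2) / 2

/-- The filter of neighbourhoods of the boundary of `Ω`: complements of compact subsets. -/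
def boundaryFilter (Ω : Set ℂ) : Filter ℂ := Filter.map Subtype.val (Filter.cocompact Ω)

lemma eventually_boundaryFilter {Ω : Set ℂ} {P : ℂ → Prop} :
    (∀ᶠ z in boundaryFilter Ω, P z) ↔ ∃ K ⊆ Ω, IsCompact K ∧ ∀ z ∈ Ω \ K, P z := by
  rw [boundaryFilter, Filter.eventually_map, Filter.Eventually, Filter.mem_cocompact]
  constructor
  · rintro ⟨t, ht, hP⟩
    refine ⟨Subtype.val '' t, by simp, ht.image continuous_subtype_val, fun z hz => ?_⟩
    refine @hP ⟨z, hz.1⟩ fun h => hz.2 ⟨_, h, rfl⟩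
  · rintro ⟨K, hKΩ, hK, hP⟩
    refine ⟨Subtype.val ⁻¹' K, ?_, fun z hz => hP z ⟨z.2, hz⟩⟩
    exact Topology.IsInducing.subtypeVal.isCompact_preimage' hK (by simpa using hKΩ)

lemma eventually_mem_boundaryFilter (Ω : Set ℂ) : ∀ᶠ z in boundaryFilter Ω, z ∈ Ω :=
  eventually_boundaryFilter.2 ⟨∅, by simp, isCompact_empty, fun _ hz => hz.1⟩

lemma eventually_ne_boundaryFilter {Ω : Set ℂ} {a : ℂ} (ha : a ∈ Ω) :
    ∀ᶠ z in boundaryFilter Ω, z ≠ a :=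
  eventually_boundaryFilter.2 ⟨{a}, by simpa, isCompact_singleton, fun _ hz => hz.2⟩

lemma tendsto_boundaryFilter_of_continuousAt {Ω : Set ℂ} (hb : Bornology.IsBounded Ω)
    {e : ℂ → ℂ} (hc : ∀ z ∉ Ω, ContinuousAt e z) (h0 : ∀ z ∉ Ω, e z = 0) :
    Filter.Tendsto e (boundaryFilter Ω) (nhds 0) := by
  rw [Metric.tendsto_nhds]
  intro ε hε
  set V := {z | dist (e z) 0 < ε}
  refine eventually_boundaryFilter.2 ⟨closure Ω \ interior V, fun z hz => ?_,
    hb.isCompact_closure.diff isOpen_interior, fun z hz => ?_⟩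
  · by_contra hzΩ
    refine hz.2 (mem_interior_iff_mem_nhds.2 ?_)
    have := hc z hzΩ
    rw [ContinuousAt, h0 z hzΩ] at this
    exact this (ball_mem_nhds _ hε)
  · by_contra hzV
    exact hz.2 ⟨subset_closure hz.1, fun h => hzV (interior_subset (s := V) h)⟩

/-- The boundary values of the conjugate of `a` are `b / f ^ m`. -/
structure Matched (Ω : Set ℂ) (f : ℂ → ℂ) (m : ℕ) (a b : ℂ → ℂ) : Prop where
  left : DifferentiableOn ℂ a Ω
  right : DifferentiableOn ℂ b Ω
  bdd : ∃ C : ℝ, ∀ z ∈ Ω, ‖a z‖ ≤ C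
  tendsto : Filter.Tendsto (fun z => conj (a z) * f z ^ m - b z) (boundaryFilter Ω) (nhds 0)

lemma Filter.Tendsto.zero_mul_of_bdd {Ω : Set ℂ} {a b : ℂ → ℂ}
    (ha : Filter.Tendsto a (boundaryFilter Ω) (nhds 0)) (hb : ∃ C : ℝ, ∀ z ∈ Ω, ‖b z‖ ≤ C) :
    Filter.Tendsto (fun z => a z * b z) (boundaryFilter Ω) (nhds 0) := by
  obtain ⟨C, hC⟩ := hb
  refine ha.zero_mul_isBoundedUnder_le ⟨C, ?_⟩
  rw [Filter.eventually_map]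
  filter_upwards [eventually_mem_boundaryFilter Ω] with z hz using hC z hz

namespace Matched

variable {Ω : Set ℂ} {f a b a' b' : ℂ → ℂ} {m m' : ℕ}

lemma add (h : Matched Ω f m a b) (h' : Matched Ω f m a' b') :
    Matched Ω f m (fun z => a z + a' z) (fun z => b z + b' z) where
  left := h.left.add h'.left
  right := h.right.add h'.right
  bdd := by
    obtain ⟨C, hC⟩ := h.bdd
    obtain ⟨C', hC'⟩ := h'.bdd
    exact ⟨C + C', fun z hz => norm_add_le_of_le (hC z hz) (hC' z hz)⟩
  tendsto := by
    have := h.tendsto.add h'.tendsto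
    rw [add_zero] at this
    refine this.congr fun z => ?_
    rw [map_add]; ring

lemma const_mul (h : Matched Ω f m a b) (c : ℂ) :
    Matched Ω f m (fun z => c * a z) (fun z => conj c * b z) where
  left := h.left.const_mul c
  right := h.right.const_mul _
  bdd := by
    obtain ⟨C, hC⟩ := h.bdd
    refine ⟨‖c‖ * C, fun z hz => ?_⟩
    rw [norm_mul]
    gcongr
    exact hC z hz
  tendsto := by
    have := h.tendsto.const_mul (conj c)
    rw [mul_zero] at this
    refine this.congr fun z => ?_
    rw [map_mul]; ring

lemma mul (h : Matched Ω f m a b) (h' : Matched Ω f m' a' b') (hf : ∀ z ∈ Ω, ‖f z‖ ≤ 1) :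
    Matched Ω f (m + m') (fun z => a z * a' z) (fun z => b z * b' z) where
  left := h.left.mul h'.left
  right := h.right.mul h'.right
  bdd := by
    obtain ⟨C, hC⟩ := h.bdd
    obtain ⟨C', hC'⟩ := h'.bdd
    exact ⟨C * C', fun z hz => norm_mul_le_of_le (hC z hz) (hC' z hz)⟩
  tendsto := by
    have hbd : ∀ {a : ℂ → ℂ} {m : ℕ}, (∃ C : ℝ, ∀ z ∈ Ω, ‖a z‖ ≤ C) →
        ∃ C : ℝ, ∀ z ∈ Ω, ‖conj (a z) * f z ^ m‖ ≤ C := by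
      rintro a m ⟨C, hC⟩
      refine ⟨C * 1, fun z hz => norm_mul_le_of_le ?_ ?_⟩
      · simpa using hC z hz
      · rw [norm_pow]; exact pow_le_one₀ (norm_nonneg _) (hf z hz)
    have h1 := h.tendsto.zero_mul_of_bdd (hbd h'.bdd (m := m'))
    have h2 := h'.tendsto.zero_mul_of_bdd (hbd h.bdd (m := m))
    have h3 := (h1.add h2).sub (h.tendsto.mul h'.tendsto)
    simp only [mul_zero, add_zero, sub_zero] at h3
    refine h3.congr fun z => ?_
    rw [map_mul]; ring

lemma one : Matched Ω f 0 (fun _ => 1) (fun _ => 1) where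
  left := by fun_prop
  right := by fun_prop
  bdd := ⟨1, by simp⟩
  tendsto := by simpa using tendsto_const_nhds

lemma one_self (hfd : DifferentiableOn ℂ f Ω) :
    Matched Ω f 1 (fun _ => 1) f where
  left := by fun_prop
  right := hfd
  bdd := ⟨1, by simp⟩
  tendsto := by simpa using tendsto_const_nhds

lemma pow (h : Matched Ω f m a b) (hf : ∀ z ∈ Ω, ‖f z‖ ≤ 1) (k : ℕ) :
    Matched Ω f (m * k) (fun z => a z ^ k) (fun z => b z ^ k) := by
  induction k with
  | zero => simpa using one
  | succ k ih => simpa only [pow_succ, mul_add, mul_one] using ih.mul h hf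

lemma prod {ι : Type*} (s : Finset ι) {m : ι → ℕ} {a b : ι → ℂ → ℂ}
    (h : ∀ i ∈ s, Matched Ω f (m i) (a i) (b i)) (hf : ∀ z ∈ Ω, ‖f z‖ ≤ 1) :
    Matched Ω f (∑ i ∈ s, m i) (fun z => ∏ i ∈ s, a i z) (fun z => ∏ i ∈ s, b i z) := by
  classical
  induction s using Finset.induction_on with
  | empty => simpa using one
  | insert i s hi ih =>
    simp only [Finset.sum_insert hi, Finset.prod_insert hi]
    exact (h i (by simp)).mul (ih fun j hj => h j (by simp [hj])) hf

lemma sum {ι : Type*} (s : Finset ι) {a b : ι → ℂ → ℂ}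
    (h : ∀ i ∈ s, Matched Ω f m (a i) (b i)) :
    Matched Ω f m (fun z => ∑ i ∈ s, a i z) (fun z => ∑ i ∈ s, b i z) := by
  classical
  induction s using Finset.induction_on with
  | empty =>
    exact ⟨by simp, by simp, ⟨0, by simp⟩, by simpa using tendsto_const_nhds⟩
  | insert i s hi ih =>
    simp only [Finset.sum_insert hi]
    exact (h i (by simp)).add (ih fun j hj => h j (by simp [hj]))

end Matched

lemma IsProperOntoDisc.norm_le_one {Ω : Set ℂ} {f : ℂ → ℂ} (hf : IsProperOntoDisc Ω f) :
    ∀ z ∈ Ω, ‖f z‖ ≤ 1 := by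
  intro z hz
  have : f z ∈ ball (0 : ℂ) 1 := hf.2.1 ▸ mem_image_of_mem f hz
  exact (by simpa using this : ‖f z‖ < 1).le

lemma IsProperOntoDisc.tendsto_conj_mul {Ω : Set ℂ} {f : ℂ → ℂ} (hf : IsProperOntoDisc Ω f) :
    Filter.Tendsto (fun z => conj (f z) * f z) (boundaryFilter Ω) (nhds 1) := by
  have h1 : Filter.Tendsto (fun z => ‖f z‖) (boundaryFilter Ω) (nhds 1) := by
    rw [Metric.tendsto_nhds]
    intro ε hε
    refine eventually_boundaryFilter.2 ⟨Ω ∩ f ⁻¹' closedBall 0 (1 - ε), inter_subset_left,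
      hf.2.2 _ (closedBall_subset_ball (by linarith)) (isCompact_closedBall _ _), fun z hz => ?_⟩
    have h2 : 1 - ε < ‖f z‖ := by
      by_contra! h
      exact hz.2 ⟨hz.1, by simpa using h⟩
    have h3 := hf.norm_le_one z hz.1
    rw [Real.dist_eq, abs_lt]
    constructor <;> linarith
  have h2 := (Complex.continuous_ofReal.tendsto _).comp (h1.pow 2)
  rw [one_pow, ofReal_one] at h2
  refine h2.congr fun z => ?_
  rw [mul_comm, Complex.mul_conj, normSq_eq_norm_sq]
  rfl

lemma IsProperOntoDisc.matched_self {Ω : Set ℂ} {f : ℂ → ℂ} (hf : IsProperOntoDisc Ω f) :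
    Matched Ω f 1 f (fun _ => 1) where
  left := hf.1
  right := by fun_prop
  bdd := ⟨1, hf.norm_le_one⟩
  tendsto := by
    have := hf.tendsto_conj_mul.sub_const 1
    simpa using this

lemma IsProperOntoDisc.matched_blaschke {Ω : Set ℂ} {f : ℂ → ℂ} (hf : IsProperOntoDisc Ω f)
    (b : ℂ) : Matched Ω f 1 (fun z => 1 - conj b * f z) (fun z => f z - b) := by
  have := (Matched.one_self hf.1).add (hf.matched_self.const_mul (-conj b))
  simpa [sub_eq_add_neg] using this

lemma exists_norm_nodeKernel_le {N : ℕ} (w : Fin N → ℂ) (n : Fin N → ℕ) (c : Fin N → ℕ → ℂ) :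
    ∃ ρ C : ℝ, (∀ j, ‖w j‖ ≤ ρ) ∧ ∀ z, ρ < ‖z‖ → ‖nodeKernel w n c z‖ ≤ C := by
  obtain ⟨R, hR⟩ : ∃ R : ℝ, ∀ j, ‖w j‖ ≤ R := by
    obtain ⟨R, hR⟩ := (Set.finite_range fun j => ‖w j‖).bddAbove
    exact ⟨R, fun j => hR ⟨j, rfl⟩⟩
  refine ⟨R + 1, ∑ j, ∑ k ∈ Finset.range (n j + 1), ‖c j k‖ * (k.factorial * 1),
    fun j => (hR j).trans (by linarith), fun z hz => ?_⟩
  refine norm_sum_le_of_le _ fun j _ => norm_sum_le_of_le _ fun k _ => ?_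
  have h1 : 1 ≤ ‖w j - z‖ := by
    have := norm_sub_norm_le z (w j)
    rw [norm_sub_rev] at this
    linarith [hR j]
  rw [norm_mul, norm_mul, norm_mul, norm_inv, norm_pow, norm_pow]
  simp only [norm_neg, norm_one, one_pow, one_mul, Complex.norm_natCast]
  gcongr
  exact inv_le_one_of_one_le₀ (one_le_pow₀ h1)

lemma exists_mul_inv_sub_pow {Ω : Set ℂ} (ho : IsOpen Ω) {f Q : ℂ → ℂ}
    (hf : DifferentiableOn ℂ f Ω) (hQ : DifferentiableOn ℂ Q Ω) {a : ℂ} (ha : a ∈ Ω) (m : ℕ) :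
    ∃ T : ℂ → ℂ, DifferentiableOn ℂ T Ω ∧
      ∀ z, z ≠ a → T z = ((a - z) ^ m)⁻¹ * ((f z - f a) ^ m * Q z) := by
  have hd : DifferentiableOn ℂ (dslope f a) Ω :=
    (Complex.differentiableOn_dslope (ho.mem_nhds ha)).2 hf
  refine ⟨fun z => (-dslope f a z) ^ m * Q z, (hd.neg.pow m).mul hQ, fun z hz => ?_⟩
  have : a - z ≠ 0 := sub_ne_zero.2 hz.symm
  have : z - a ≠ 0 := sub_ne_zero.2 hz
  simp only
  rw [dslope_of_ne _ hz, slope_def_field, ← mul_assoc, ← inv_pow, ← mul_pow]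
  congr 2
  field_simp
  ring

lemma exists_nodeKernel_mul_prod {Ω : Set ℂ} (ho : IsOpen Ω) {f : ℂ → ℂ}
    (hf : DifferentiableOn ℂ f Ω) {N : ℕ} {w : Fin N → ℂ} (hw : ∀ j, w j ∈ Ω) (n : Fin N → ℕ)
    (c : Fin N → ℕ → ℂ) :
    ∃ T : ℂ → ℂ, DifferentiableOn ℂ T Ω ∧ ∀ z, (∀ j, z ≠ w j) →
      T z = nodeKernel w n c z * ∏ j, (f z - f (w j)) ^ (n j + 1) := by
  classical
  have hex : ∀ j, ∀ k ∈ Finset.range (n j + 1), ∃ T : ℂ → ℂ, DifferentiableOn ℂ T Ω ∧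
      ∀ z, z ≠ w j → T z = ((w j - z) ^ (k + 1))⁻¹ * ∏ i, (f z - f (w i)) ^ (n i + 1) := by
    intro j k hk
    have hQ : DifferentiableOn ℂ (fun z => (f z - f (w j)) ^ (n j - k) *
        ∏ i ∈ Finset.univ.erase j, (f z - f (w i)) ^ (n i + 1)) Ω := by
      fun_prop
    obtain ⟨T, hT, hTz⟩ := exists_mul_inv_sub_pow ho hf hQ (hw j) (k + 1)
    refine ⟨T, hT, fun z hz => ?_⟩
    rw [hTz z hz, ← Finset.mul_prod_erase _ _ (Finset.mem_univ j), ← mul_assoc (_ ^ (k + 1)),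
      ← pow_add]
    rw [Finset.mem_range] at hk
    rw [show k + 1 + (n j - k) = n j + 1 by lia]
  choose! T hT hTz using hex
  refine ⟨fun z => ∑ j, ∑ k ∈ Finset.range (n j + 1), c j k * ((-1) ^ k * k.factorial) * T j k z,
    ?_, fun z hz => ?_⟩
  · refine DifferentiableOn.fun_sum fun j _ => DifferentiableOn.fun_sum fun k hk => ?_
    exact (hT j k hk).const_mul _
  · unfold nodeKernel
    rw [Finset.sum_mul]
    refine Finset.sum_congr rfl fun j _ => ?_
    rw [Finset.sum_mul]
    refine Finset.sum_congr rfl fun k hk => ?_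
    rw [hTz j k hk z (hz j)]
    ring

lemma exists_matched_mul_eval {Ω : Set ℂ} (hΩ : IsFinConnDomain Ω) (hA : volume Ω < ⊤)
    (hq : IsQuadratureDomain Ω) {f : ℂ → ℂ} (hf : IsProperOntoDisc Ω f) :
    ∃ (B : Polynomial ℂ) (m : ℕ) (y : ℂ → ℂ), B ≠ 0 ∧
      Matched Ω f m (fun z => z * B.eval (f z)) y := by
  obtain ⟨ho, hconn, -, hcomp⟩ := hΩ
  obtain ⟨N, -, w, n, c, hw, hquad⟩ := hq
  have hzero : ∀ ζ ∉ Ω, cauchyTransform Ω ζ - nodeKernel w n c ζ = 0 := fun ζ hζ =>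
    sub_eq_zero.2 (cauchyTransform_eq_nodeKernel ho hA hw hquad hζ (hcomp ζ hζ))
  set e : ℂ → ℂ := fun ζ => (cauchyTransform Ω ζ - nodeKernel w n c ζ) / Real.pi with he
  have he0 : ∀ ζ ∉ Ω, e ζ = 0 := fun ζ hζ => by rw [he]; simp only [hzero ζ hζ, zero_div]
  have hec : ∀ ζ, (∀ j, w j ≠ ζ) → ContinuousAt e ζ := fun ζ hζ =>
    ((continuous_cauchyTransform hA).continuousAt.sub
      (differentiableAt_nodeKernel hζ).continuousAt).div_const _
  have hschwarz := differentiableOn_conj_add_cauchyTransform ho hA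
  obtain ⟨ρ, C, hρ, hC⟩ := exists_norm_nodeKernel_le w n c
  obtain ⟨M, hM0, hM⟩ := exists_norm_cauchyTransform_le hA
  have hne : ∀ z, ρ < ‖z‖ → ∀ j, w j ≠ z := by
    rintro z hz j rfl
    exact absurd (hρ j) (not_le.2 hz)
  have hb : Bornology.IsBounded Ω := by
    refine isBounded_of_schwarz ho (e := e) (ρ := ρ) (ε := (M + C) / Real.pi) ?_ ?_ he0 ?_
    · exact fun z hz => (hec z (hne z hz)).continuousWithinAt
    · have : DifferentiableOn ℂ (fun z => (conj z + cauchyTransform Ω z / Real.pi) -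
          nodeKernel w n c z / Real.pi) (Ω ∩ {z | ρ < ‖z‖}) :=
        (hschwarz.mono inter_subset_left).sub fun z hz =>
          ((differentiableAt_nodeKernel (hne z hz.2)).div_const _).differentiableWithinAt
      refine this.congr fun z _ => ?_
      simp only [he]; ring
    · intro z hz
      simp only [he]
      rw [norm_div, Complex.norm_real, Real.norm_of_nonneg Real.pi_pos.le]
      gcongr
      exact norm_sub_le_of_le ((norm_integral_le_integral_norm _).trans (hM z)) (hC z hz)
  have hetend : Filter.Tendsto e (boundaryFilter Ω) (nhds 0) :=
    tendsto_boundaryFilter_of_continuousAt hb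
      (fun z hz => hec z fun j (h : w j = z) => hz (h ▸ hw j)) he0
  obtain ⟨T, hT, hTz⟩ := exists_nodeKernel_mul_prod ho hf.1 hw n c
  have hmatch := Matched.prod Finset.univ (fun j _ => (hf.matched_blaschke (f (w j))).pow
    hf.norm_le_one (n j + 1)) hf.norm_le_one
  obtain ⟨R, hR⟩ := isBounded_iff_forall_norm_le.1 hb
  refine ⟨∏ j, (1 - Polynomial.C (conj (f (w j))) * Polynomial.X) ^ (n j + 1),
    ∑ j, 1 * (n j + 1), fun z => (conj z + cauchyTransform Ω z / Real.pi) *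
      ∏ j, (f z - f (w j)) ^ (n j + 1) - T z / Real.pi, ?_, ?_⟩
  · rw [Finset.prod_ne_zero_iff]
    refine fun j _ => pow_ne_zero _ fun h => ?_
    simpa using congrArg (Polynomial.eval 0) h
  have hev : ∀ z, (∏ j, (1 - Polynomial.C (conj (f (w j))) * Polynomial.X) ^ (n j + 1)).eval (f z) =
      ∏ j, (1 - conj (f (w j)) * f z) ^ (n j + 1) := fun z => by
    rw [Polynomial.eval_prod]; simp
  simp only [hev]
  refine ⟨differentiableOn_id.mul hmatch.left, (hschwarz.mul hmatch.right).sub (hT.div_const _),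
    ?_, ?_⟩
  · obtain ⟨C', hC'⟩ := hmatch.bdd
    exact ⟨R * C', fun z hz => norm_mul_le_of_le (hR z hz) (hC' z hz)⟩
  · have hDb : ∃ C : ℝ, ∀ z ∈ Ω, ‖∏ j, (f z - f (w j)) ^ (n j + 1)‖ ≤ C := by
      refine ⟨∏ j, 2 ^ (n j + 1), fun z hz => ?_⟩
      rw [norm_prod]
      refine Finset.prod_le_prod (fun _ _ => norm_nonneg _) fun j _ => ?_
      rw [norm_pow]
      gcongr
      linarith [norm_sub_le (f z) (f (w j)), hf.norm_le_one z hz, hf.norm_le_one _ (hw j)]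
    have h1 := hmatch.tendsto.zero_mul_of_bdd (b := fun z => conj z) ⟨R, by simpa using hR⟩
    have h2 := h1.sub (hetend.zero_mul_of_bdd hDb)
    rw [sub_zero] at h2
    refine h2.congr' ?_
    have hnode : ∀ᶠ z in boundaryFilter Ω, ∀ j, z ≠ w j :=
      Filter.eventually_all.2 fun j => eventually_ne_boundaryFilter (hw j)
    filter_upwards [hnode] with z hz
    rw [hTz z hz, map_mul]
    simp only [he]
    ring

/-- A linear combination of sufficiently many analytic functions vanishes to prescribed orders. -/
lemma exists_ne_zero_le_analyticOrderAt_sum {ι : Type*} [Fintype ι] {u : ι → ℂ → ℂ}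
    {Z : Finset ℂ} {ν : ℂ → ℕ} (hu : ∀ i, ∀ p ∈ Z, AnalyticAt ℂ (u i) p)
    (hcard : ∑ p ∈ Z, ν p < Fintype.card ι) :
    ∃ c : ι → ℂ, c ≠ 0 ∧ ∀ p ∈ Z, ν p ≤ analyticOrderAt (fun z => ∑ i, c i * u i z) p := by
  classical
  set L : (ι → ℂ) →ₗ[ℂ] ((Σ p : Z, Fin (ν p)) → ℂ) :=
    Matrix.toLin' (Matrix.of fun (q : Σ p : Z, Fin (ν p)) i => iteratedDeriv q.2 (u i) q.1)
  have hker : LinearMap.ker L ≠ ⊥ := by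
    refine LinearMap.ker_ne_bot_of_finrank_lt ?_
    simpa [Finset.sum_attach Z ν] using hcard
  obtain ⟨c, hc, hc0⟩ := Submodule.exists_mem_ne_zero_of_ne_bot hker
  refine ⟨c, hc0, fun p hp => ?_⟩
  have ha : AnalyticAt ℂ (fun z => ∑ i, c i * u i z) p :=
    Finset.analyticAt_fun_sum _ fun i _ => analyticAt_const.mul (hu i p hp)
  refine (natCast_le_analyticOrderAt_iff_iteratedDeriv_eq_zero ha).2 fun k hk => ?_
  have h1 := congrFun (LinearMap.mem_ker.1 hc) ⟨⟨p, hp⟩, ⟨k, hk⟩⟩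
  have hci : ∀ i ∈ Finset.univ, ContDiffAt ℂ k (fun z => c i * u i z) p := fun i _ =>
    (analyticAt_const.mul (hu i p hp)).contDiffAt
  rw [iteratedDeriv_fun_sum hci]
  simp_rw [iteratedDeriv_const_mul_field]
  simpa [L, Matrix.toLin'_apply, Matrix.mulVec, dotProduct, mul_comm] using h1

lemma differentiableAt_div_pow {f h : ℂ → ℂ} {p : ℂ} (hf : AnalyticAt ℂ f p)
    (hh : AnalyticAt ℂ h p) {ν M : ℕ} (hM : M ≠ 0) (hν : ν ≠ 0) (hfν : analyticOrderAt f p = ν)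
    (hhν : ((M + 1) * ν : ℕ) ≤ analyticOrderAt h p) :
    DifferentiableAt ℂ (fun z => h z / f z ^ M) p := by
  obtain ⟨u, hu, hup, hfu⟩ := (hf.analyticOrderAt_eq_natCast).1 hfν
  obtain ⟨h₁, hh₁, hhh₁⟩ := (natCast_le_analyticOrderAt hh).1 hhν
  have hd : DifferentiableAt ℂ (fun z => (z - p) ^ ν * (h₁ z / u z ^ M)) p := by
    have := hh₁.differentiableAt
    have := hu.differentiableAt
    have := pow_ne_zero M hup
    fun_prop (disch := assumption)
  refine hd.congr_of_eventuallyEq ?_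
  filter_upwards [hfu, hhh₁, hu.continuousAt.eventually_ne hup] with z h1 h2 h3
  rw [h1, h2, smul_eq_mul, smul_eq_mul]
  rcases eq_or_ne z p with rfl | hz
  · simp [hν, hM]
  · have : z - p ≠ 0 := sub_ne_zero.2 hz
    field_simp
    ring

lemma IsProperOntoDisc.exists_apply_eq_zero {Ω : Set ℂ} {f : ℂ → ℂ} (hf : IsProperOntoDisc Ω f) :
    ∃ p ∈ Ω, f p = 0 := by
  have : (0 : ℂ) ∈ f '' Ω := by rw [hf.2.1]; simp
  exact this

lemma IsProperOntoDisc.not_eqOn_zero {Ω : Set ℂ} {f : ℂ → ℂ} (hf : IsProperOntoDisc Ω f) :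
    ¬ EqOn f 0 Ω := by
  intro h
  have : (1 / 2 : ℂ) ∈ f '' Ω := by rw [hf.2.1]; norm_num
  obtain ⟨p, hp, hp2⟩ := this
  rw [h hp] at hp2
  norm_num at hp2

lemma IsProperOntoDisc.finite_zeros {Ω : Set ℂ} (ho : IsOpen Ω) (hΩ : IsConnected Ω) {f : ℂ → ℂ}
    (hf : IsProperOntoDisc Ω f) : (Ω ∩ f ⁻¹' {0}).Finite := by
  by_contra hinf
  obtain ⟨p, hp, hacc⟩ := Set.Infinite.exists_accPt_of_subset_isCompact hinf
    (hf.2.2 {0} (by simp) isCompact_singleton) subset_rfl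
  rw [accPt_iff_frequently_nhdsNE] at hacc
  exact hf.not_eqOn_zero ((hf.1.analyticOnNhd ho).eqOn_zero_of_preconnected_of_frequently_eq_zero
    hΩ.isPreconnected hp.1 (hacc.mono fun z hz => hz.2))

/-- If a matched function vanishes at the zeros of `f` to order larger than that of `f ^ M`,
then it vanishes identically. -/
lemma Matched.eq_zero_of_order {Ω : Set ℂ} (ho : IsOpen Ω) (hΩ : IsConnected Ω) {f : ℂ → ℂ}
    (hf : IsProperOntoDisc Ω f) {M : ℕ} (hM : M ≠ 0) {h g : ℂ → ℂ} (hm : Matched Ω f M h g)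
    (hord : ∀ p ∈ Ω, f p = 0 →
      ((M + 1) * analyticOrderNatAt f p : ℕ) ≤ analyticOrderAt h p) :
    ∀ z ∈ Ω, h z = 0 := by
  have hfa := hf.1.analyticOnNhd ho
  have hha := hm.left.analyticOnNhd ho
  have htop : ∀ p ∈ Ω, analyticOrderAt f p = analyticOrderNatAt f p := by
    intro p hp
    refine (Nat.cast_analyticOrderNatAt fun htop => ?_).symm
    exact hf.not_eqOn_zero (hfa.eqOn_zero_of_preconnected_of_eventuallyEq_zero
      hΩ.isPreconnected hp (analyticOrderAt_eq_top.1 htop))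
  have hpos : ∀ p ∈ Ω, f p = 0 → analyticOrderNatAt f p ≠ 0 := by
    intro p hp h0 h1
    have h2 := htop p hp
    rw [h1, Nat.cast_zero] at h2
    exact (hfa p hp).analyticOrderAt_eq_zero.1 h2 h0
  set G : ℂ → ℂ := fun z => h z / f z ^ M with hG
  have hGd : DifferentiableOn ℂ G Ω := by
    intro z hz
    refine DifferentiableAt.differentiableWithinAt ?_
    by_cases h0 : f z = 0
    · exact differentiableAt_div_pow (hfa z hz) (hha z hz) hM (hpos z hz h0) (htop z hz)
        (hord z hz h0)
    · exact (hha z hz).differentiableAt.div ((hfa z hz).differentiableAt.pow M) (pow_ne_zero _ h0)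
  have ht : Filter.Tendsto (fun z => conj (G z) - g z) (boundaryFilter Ω) (nhds 0) := by
    have hφ : Filter.Tendsto (fun z => (1 - (conj (f z) * f z) ^ M) / (conj (f z) * f z) ^ M)
        (boundaryFilter Ω) (nhds 0) := by
      have := hf.tendsto_conj_mul.pow M
      have h2 : Filter.Tendsto (fun z => (1 - (conj (f z) * f z) ^ M) / (conj (f z) * f z) ^ M)
          (boundaryFilter Ω) (nhds ((1 - 1 ^ M) / 1 ^ M)) :=
        (this.const_sub 1).div this (by simp)
      simpa using h2
    have hb : ∃ C : ℝ, ∀ z ∈ Ω, ‖conj (h z) * f z ^ M‖ ≤ C := by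
      obtain ⟨C, hC⟩ := hm.bdd
      refine ⟨C * 1, fun z hz => norm_mul_le_of_le (by simpa using hC z hz) ?_⟩
      rw [norm_pow]
      exact pow_le_one₀ (norm_nonneg _) (hf.norm_le_one z hz)
    have h1 := (hφ.zero_mul_of_bdd hb).add hm.tendsto
    rw [add_zero] at h1
    refine h1.congr' ?_
    filter_upwards [hf.tendsto_conj_mul.eventually_ne one_ne_zero] with z hz
    have h3 : f z ≠ 0 := right_ne_zero_of_mul hz
    have h4 : conj (f z) ≠ 0 := left_ne_zero_of_mul hz
    simp only [hG, map_div₀, map_pow]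
    rw [mul_pow]
    field_simp
    ring
  have hconst := eq_of_conj_sub_small ho hΩ hGd hm.right fun ε hε => by
    rw [Metric.tendsto_nhds] at ht
    obtain ⟨K, hKΩ, hK, h⟩ := eventually_boundaryFilter.1 (ht ε hε)
    exact ⟨K, hKΩ, hK, fun z hz => by simpa using (h z hz).le⟩
  obtain ⟨p, hp, hp0⟩ := hf.exists_apply_eq_zero
  intro z hz
  by_cases h0 : f z = 0
  · refine apply_eq_zero_of_analyticOrderAt_ne_zero (𝕜 := ℂ) fun h1 => ?_
    have h2 := hord z hz h0
    rw [h1] at h2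
    have h3 : (M + 1) * analyticOrderNatAt f z = 0 := by simpa using h2
    exact hpos z hz h0 (by simpa using h3)
  · have h1 := hconst z hz p hp
    simp only [hG, hp0, zero_pow hM, div_zero, div_eq_zero_iff] at h1
    exact h1.resolve_right (pow_ne_zero _ h0)

lemma Matched.exists_polynomial {Ω : Set ℂ} (ho : IsOpen Ω) (hΩ : IsConnected Ω) {f : ℂ → ℂ}
    (hf : IsProperOntoDisc Ω f) {m : ℕ} {x y : ℂ → ℂ} (hx : Matched Ω f m x y) :
    ∃ P : Polynomial (Polynomial ℂ), P ≠ 0 ∧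
      ∀ z ∈ Ω, P.eval₂ (Polynomial.evalRingHom (f z)) (x z) = 0 := by
  classical
  set Z := (hf.finite_zeros ho hΩ).toFinset
  have hZ : ∀ p, p ∈ Z ↔ p ∈ Ω ∧ f p = 0 := by simp [Z]
  set d := ∑ p ∈ Z, analyticOrderNatAt f p with hd
  set B := m * d ^ 2 + 1 with hB
  set M := m * d + B with hM
  set u : Fin (d + 1) × Fin (B + 1) → ℂ → ℂ := fun q z => x z ^ (q.1 : ℕ) * f z ^ (q.2 : ℕ)
  have hu : ∀ q, ∃ v, Matched Ω f M (u q) v := by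
    rintro ⟨⟨i, hi⟩, ⟨j, hj⟩⟩
    have h1 := ((hx.pow hf.norm_le_one i).mul (hf.matched_self.pow hf.norm_le_one j)
      hf.norm_le_one).mul ((Matched.one_self hf.1).pow hf.norm_le_one (m * (d - i) + (B - j)))
      hf.norm_le_one
    have h2 : m * i + 1 * j + 1 * (m * (d - i) + (B - j)) = M := by
      have h3 : m * i + m * (d - i) = m * d := by
        rw [← Nat.mul_add, Nat.add_sub_of_le (Nat.lt_succ_iff.1 hi)]
      lia
    rw [h2] at h1
    simp only [one_pow, mul_one] at h1
    exact ⟨_, h1⟩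
  choose v hv using hu
  obtain ⟨c, hc0, hc⟩ := exists_ne_zero_le_analyticOrderAt_sum (u := u) (Z := Z)
    (ν := fun p => (M + 1) * analyticOrderNatAt f p)
    (fun q p hp => (hv q).left.analyticAt (ho.mem_nhds ((hZ p).1 hp).1)) (by
      rw [← Finset.mul_sum, ← hd]
      simp only [Fintype.card_prod, Fintype.card_fin]
      rw [hM, hB]
      nlinarith)
  have hm := Matched.sum Finset.univ fun q _ => (hv q).const_mul (c q)
  have hzero := hm.eq_zero_of_order ho hΩ hf (by lia) fun p hp hp0 => hc p ((hZ p).2 ⟨hp, hp0⟩)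
  refine ⟨∑ q, Polynomial.monomial (q.1 : ℕ) (Polynomial.monomial (q.2 : ℕ) (c q)), ?_, ?_⟩
  · obtain ⟨q, hq⟩ := Function.ne_iff.1 hc0
    intro h0
    have h1 := congrArg (fun P => (P.coeff (q.1 : ℕ)).coeff (q.2 : ℕ)) h0
    simp only [Polynomial.finsetSum_coeff, Polynomial.coeff_zero] at h1
    rw [Finset.sum_eq_single q] at h1
    · simp at h1
      exact hq h1
    · rintro ⟨i, j⟩ - hne
      rw [Polynomial.coeff_monomial]
      split_ifs with hi
      · rw [Polynomial.coeff_monomial, if_neg]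
        exact fun hj => hne (Prod.ext (Fin.ext hi) (Fin.ext hj))
      · simp
    · simp
  · intro z hz
    rw [← hzero z hz, Polynomial.eval₂_finsetSum]
    refine Finset.sum_congr rfl fun q _ => ?_
    simp [u, Polynomial.eval₂_monomial, Polynomial.eval_monomial]
    ring

open Polynomial in
/-- If `z` is algebraic over `R[X]` and `w` satisfies the relations obtained by differentiating
the algebraic relations of `z`, then `w` is algebraic over `R[X]` as well. -/
lemma IsAlgebraic.of_derivative_relation {R S : Type*} [CommRing R] [IsDomain R] [CharZero R]
    [CommRing S] [IsDomain S] [Algebra R[X] S] [FaithfulSMul R[X] S] {z w : S}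
    (hz : IsAlgebraic R[X] z)
    (hw : ∀ p : R[X][X], aeval z p = 0 →
      (p.sum fun i a => algebraMap R[X] S (derivative a) * z ^ i) * w
        + aeval z (derivative p) = 0) :
    IsAlgebraic R[X] w := by
  classical
  have hex : ∃ n : ℕ, ∃ p : R[X][X], p ≠ 0 ∧ aeval z p = 0 ∧ p.natDegree = n := by
    obtain ⟨p, hp, hpz⟩ := hz
    exact ⟨_, p, hp, hpz, rfl⟩
  obtain ⟨p, hp, hpz, hpn⟩ := Nat.find_spec hex
  have hdeg : p.natDegree ≠ 0 := by
    intro h0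
    rw [Polynomial.eq_C_of_natDegree_eq_zero h0, aeval_C,
      FaithfulSMul.algebraMap_eq_zero_iff] at hpz
    rw [Polynomial.eq_C_of_natDegree_eq_zero h0, hpz] at hp
    simp at hp
  have hder : aeval z (derivative p) ≠ 0 := by
    intro h0
    have h1 : derivative p ≠ 0 := fun h => hdeg (derivative_eq_zero.1 h)
    exact Nat.find_min hex (hpn ▸ natDegree_derivative_lt hdeg) ⟨_, h1, h0, rfl⟩
  have hrel := hw p hpz
  set A := Subalgebra.algebraicClosure R[X] S
  have hzA : z ∈ A := hz
  set N := p.sum fun i a => algebraMap R[X] S (derivative a) * z ^ i with hN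
  have hNA : N ∈ A := by
    rw [hN, Polynomial.sum_def]
    exact sum_mem fun i _ => mul_mem (A.algebraMap_mem _) (pow_mem hzA i)
  have hN0 : N ≠ 0 := by
    intro h0
    rw [h0, zero_mul, zero_add] at hrel
    exact hder hrel
  refine IsAlgebraic.of_mul (mem_nonZeroDivisors_of_ne_zero hN0) hNA ?_
  rw [eq_neg_of_add_eq_zero_left hrel]
  have h1 : aeval z (derivative p) ∈ A := by
    rw [aeval_eq_sum_range]
    exact sum_mem fun i _ => A.smul_mem (pow_mem hzA i) _
  exact neg_mem h1

/-- The algebra of holomorphic functions on `Ω`. -/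
def holoSubalgebra (Ω : Set ℂ) : Subalgebra ℂ (Ω → ℂ) where
  carrier := {g | ∃ G, DifferentiableOn ℂ G Ω ∧ g = Ω.domRestrict G}
  mul_mem' := by
    rintro _ _ ⟨F, hF, rfl⟩ ⟨G, hG, rfl⟩
    exact ⟨F * G, hF.mul hG, rfl⟩
  add_mem' := by
    rintro _ _ ⟨F, hF, rfl⟩ ⟨G, hG, rfl⟩
    exact ⟨F + G, hF.add hG, rfl⟩
  algebraMap_mem' c := ⟨fun _ => c, differentiableOn_const c, rfl⟩

/-- A holomorphic function on `Ω` as an element of `holoSubalgebra Ω`. -/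
def holoSubalgebra.mk {Ω : Set ℂ} {G : ℂ → ℂ} (hG : DifferentiableOn ℂ G Ω) : holoSubalgebra Ω :=
  ⟨Ω.domRestrict G, G, hG, rfl⟩

lemma holoSubalgebra.isDomain {Ω : Set ℂ} (ho : IsOpen Ω) (hΩ : IsConnected Ω) :
    IsDomain (holoSubalgebra Ω) := by
  have : Nonempty Ω := hΩ.nonempty.to_subtype
  have : NoZeroDivisors (holoSubalgebra Ω) := by
    refine ⟨?_⟩
    rintro ⟨_, F, hF, rfl⟩ ⟨_, G, hG, rfl⟩ h
    have h1 : ∀ z ∈ Ω, F z * G z = 0 := fun z hz =>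
      congrFun (congrArg Subtype.val h) (⟨z, hz⟩ : Ω)
    have h2 := (hF.analyticOnNhd ho).eq_zero_or_eq_zero_of_mul_eq_zero (hG.analyticOnNhd ho) h1
      hΩ.isPreconnected
    refine h2.imp (fun h => ?_) fun h => ?_ <;>
    · ext ⟨z, hz⟩
      exact h z hz
  exact NoZeroDivisors.to_isDomain _

open Polynomial in
/-- If `z * B(f)` is algebraic over the polynomials in `f`, then so is `f'`. -/
lemma exists_polynomial_deriv {Ω : Set ℂ} (ho : IsOpen Ω) (hΩ : IsConnected Ω) {f : ℂ → ℂ}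
    (hf : IsProperOntoDisc Ω f) {B : ℂ[X]} (hB : B ≠ 0) {P : ℂ[X][X]} (hP : P ≠ 0)
    (hPx : ∀ z ∈ Ω, P.eval₂ (evalRingHom (f z)) (z * B.eval (f z)) = 0) :
    ∃ Q : ℂ[X][X], Q ≠ 0 ∧ ∀ z ∈ Ω, Q.eval₂ (evalRingHom (f z)) (deriv f z) = 0 := by
  have := holoSubalgebra.isDomain ho hΩ
  set S := holoSubalgebra Ω
  set F : S := holoSubalgebra.mk hf.1
  set F' : S := holoSubalgebra.mk (hf.1.deriv ho)
  set x : S := holoSubalgebra.mk differentiableOn_id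
  let : Algebra ℂ[X] S := (aeval F).toRingHom.toAlgebra
  let ev (z : Ω) : S →ₐ[ℂ] ℂ := (Pi.evalAlgHom ℂ (fun _ : Ω => ℂ) z).comp S.val
  have hext : ∀ a : S, (∀ z, ev z a = 0) → a = 0 := fun a h => Subtype.ext (funext h)
  have hmap : ∀ (z : Ω) (a : ℂ[X]), ev z (algebraMap ℂ[X] S a) = a.eval (f z) := by
    intro z a
    change ev z (aeval F a) = _
    rw [← aeval_algHom_apply, coe_aeval_eq_eval]
    rfl
  have hcomp : ∀ z : Ω, (ev z).toRingHom.comp (algebraMap ℂ[X] S) = evalRingHom (f z) :=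
    fun z => RingHom.ext (hmap z)
  have hev : ∀ (z : Ω) (a : S) (p : ℂ[X][X]),
      ev z (aeval a p) = p.eval₂ (evalRingHom (f z)) (ev z a) := by
    intro z a p
    rw [← hcomp z]
    exact hom_eval₂ p _ (ev z).toRingHom a
  have hfaith : FaithfulSMul ℂ[X] S := by
    rw [faithfulSMul_iff_algebraMap_injective, injective_iff_map_eq_zero]
    intro a ha
    refine eq_zero_of_infinite_isRoot a (Set.Infinite.mono (s := ball (0 : ℂ) 1) ?_ ?_)
    · rw [← hf.2.1]
      rintro _ ⟨z, hz, rfl⟩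
      exact (hmap ⟨z, hz⟩ a).symm.trans (by rw [ha, map_zero])
    · exact infinite_of_mem_nhds 0 (ball_mem_nhds 0 one_pos)
  have hx : IsAlgebraic ℂ[X] x := by
    refine IsAlgebraic.of_mul (y := algebraMap ℂ[X] S B) (mem_nonZeroDivisors_of_ne_zero ?_)
      (isAlgebraic_algebraMap B) ⟨P, hP, hext _ fun z => ?_⟩
    · rwa [Ne, FaithfulSMul.algebraMap_eq_zero_iff]
    · rw [hev, map_mul, hmap, mul_comm]
      exact hPx z z.2
  have hF' : IsAlgebraic ℂ[X] F' := by
    refine hx.of_derivative_relation fun p hp => hext _ fun z => ?_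
    have h0 : ∀ w ∈ Ω, p.eval₂ (evalRingHom (f w)) w = 0 := by
      intro w hw
      rw [← map_zero (ev ⟨w, hw⟩), ← hp, hev]
      rfl
    have hfd : HasDerivAt f (deriv f z) z := (hf.1.differentiableAt (ho.mem_nhds z.2)).hasDerivAt
    have hd : HasDerivAt (fun w => p.eval₂ (evalRingHom (f w)) w)
        (p.sum fun i a => a.derivative.eval (f z) * deriv f z * (z : ℂ) ^ i
          + a.eval (f z) * (i * (z : ℂ) ^ (i - 1))) z := by
      simp only [eval₂_def, Polynomial.sum_def, coe_evalRingHom]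
      refine HasDerivAt.fun_sum fun i _ => ?_
      exact (((p.coeff i).hasDerivAt (f z)).comp (z : ℂ) hfd).mul (hasDerivAt_pow i (z : ℂ))
    have hd0 := (hd.congr_of_eventuallyEq (f₁ := fun _ => 0) (by
      filter_upwards [ho.mem_nhds z.2] with w hw using (h0 w hw).symm)).unique
      (hasDerivAt_const (z : ℂ) (0 : ℂ))
    rw [← hd0, map_add, map_mul, hev, Polynomial.sum_def, Polynomial.sum_def, map_sum,
      derivative_apply, Polynomial.sum_def, eval₂_finsetSum, Finset.sum_add_distrib,
      Finset.sum_mul]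
    congr 1
    · refine Finset.sum_congr rfl fun i _ => ?_
      rw [map_mul, map_pow, hmap]
      change _ * (z : ℂ) ^ i * deriv f z = _
      ring
    · refine Finset.sum_congr rfl fun i _ => ?_
      rw [eval₂_mul, eval₂_pow, eval₂_X, eval₂_C]
      change _ * (z : ℂ) ^ (i - 1) = _
      simp
      ring
  obtain ⟨Q, hQ, hQ0⟩ := hF'
  refine ⟨Q, hQ, fun z hz => ?_⟩
  rw [← map_zero (ev ⟨z, hz⟩), ← hQ0, hev]
  rfl

open Polynomial in
lemma exists_mvPolynomial_of_polynomial_polynomial {Q : ℂ[X][X]} (hQ : Q ≠ 0) :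
    ∃ P : MvPolynomial (Fin 2) ℂ, P ≠ 0 ∧
      ∀ a b : ℂ, MvPolynomial.eval ![a, b] P = Q.eval₂ (evalRingHom b) a := by
  have hev : ∀ a b : ℂ, MvPolynomial.eval ![a, b]
      (Q.eval₂ (aeval (MvPolynomial.X 1 : MvPolynomial (Fin 2) ℂ)).toRingHom
        (MvPolynomial.X 0)) = Q.eval₂ (evalRingHom b) a := by
    intro a b
    rw [hom_eval₂]
    congr 1
    · ext <;> simp
    · simp
  refine ⟨_, fun h0 => hQ ?_, hev⟩
  have h1 : ∀ a b : ℂ, (Q.map (evalRingHom b)).eval a = 0 := by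
    intro a b
    rw [eval_map, ← hev, h0, map_zero]
  ext i : 1
  refine Polynomial.funext fun b => ?_
  have h2 : Q.map (evalRingHom b) = 0 := Polynomial.funext fun a => by rw [h1, eval_zero]
  simpa using congrArg (coeff · i) h2

/-- if `f` is a proper holomorphic map of a quadrature domain of finite area onto
the unit disc, then `f'` and `f` are algebraically dependent. -/
theorem stmt_8 (Ω : Set ℂ) (hΩ : IsFinConnDomain Ω) (hA : volume Ω < ⊤)
    (hq : IsQuadratureDomain Ω)
    (f : ℂ → ℂ) (hf : IsProperOntoDisc Ω f) :
    ∃ P : MvPolynomial (Fin 2) ℂ, P ≠ 0 ∧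
      ∀ z ∈ Ω, MvPolynomial.eval ![deriv f z, f z] P = 0 := by
  obtain ⟨B, m, y, hB, hm⟩ := exists_matched_mul_eval hΩ hA hq hf
  obtain ⟨R, hR, hR0⟩ := hm.exists_polynomial hΩ.1 hΩ.2.1 hf
  obtain ⟨Q, hQ, hQ0⟩ := exists_polynomial_deriv hΩ.1 hΩ.2.1 hf hB hR hR0
  obtain ⟨P, hP, hPQ⟩ := exists_mvPolynomial_of_polynomial_polynomial hQ
  exact ⟨P, hP, fun z hz => (hPQ _ _).trans (hQ0 z hz)⟩
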